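/- arXiv:1812.10034 — 9 statements merged into one kernel-verified Lean document; each statement's English description precedes it below -/
import Mathlib

section
/- If G is a nontrivial connected graph and H is a nontrivial connected subgraph of G, then rvd(H) ≤ rvd(G). -/
open SimpleGraph

/-- A set of vertices is rainbow under a coloring `c` if no two of its vertices
receive the same color. -/
def RainbowSet {V : Type*} (c : V → ℕ) (S : Set V) : Prop := Set.InjOn c S

/-- `c` is a rainbow vertex-disconnection coloring of `G`: for every two distinct
vertices `x, y` there is a set `S` avoiding `x` and `y` such that every `x`-`y` walk
in `G - xy` (which is `G` itself when `x, y` are nonadjacent) meets `S` (i.e. `S` is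
an `x`-`y` vertex-cut), and moreover `S` is rainbow when `x, y` are nonadjacent,
while `S ∪ {x}` or `S ∪ {y}` is rainbow when `x, y` are adjacent. -/
def IsRVDColoring {V : Type*} (G : SimpleGraph V) (c : V → ℕ) : Prop :=
  ∀ x y : V, x ≠ y → ∃ S : Set V, x ∉ S ∧ y ∉ S ∧
    (∀ p : (G.deleteEdges {s(x, y)}).Walk x y, ∃ v ∈ p.support, v ∈ S) ∧
    (¬ G.Adj x y → RainbowSet c S) ∧
    (G.Adj x y → (RainbowSet c (insert x S) ∨ RainbowSet c (insert y S)))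

/-- The rainbow vertex-disconnection number `rvd G`: the minimum number of colors
used by a rainbow vertex-disconnection coloring of `G`. -/
noncomputable def rvd {V : Type*} (G : SimpleGraph V) : ℕ :=
  sInf {k | ∃ c : V → ℕ, IsRVDColoring G c ∧ (Set.range c).ncard = k}

/-- An injective coloring is a rainbow vertex-disconnection coloring. -/
theorem IsRVDColoring.of_injective {V : Type*} (G : SimpleGraph V) {c : V → ℕ}
    (hc : Function.Injective c) : IsRVDColoring G c := by
  intro x y hxy
  refine ⟨{x, y}ᶜ, by simp, by simp, fun p => ?_, fun _ => hc.injOn,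
    fun _ => Or.inl hc.injOn⟩
  cases p with
  | nil => exact absurd rfl hxy
  | @cons _ z _ h q =>
    refine ⟨z, by simp, ?_⟩
    rw [deleteEdges_adj] at h
    rintro (rfl | rfl)
    · exact h.1.ne rfl
    · exact h.2 rfl

/-- A rainbow vertex-disconnection coloring restricts to every subgraph. -/
theorem IsRVDColoring.subgraph {V : Type*} {G : SimpleGraph V} {c : V → ℕ}
    (hc : IsRVDColoring G c) (H : G.Subgraph) :
    IsRVDColoring H.coe (fun v => c v) := by
  intro x y hxy
  obtain ⟨S, hxS, hyS, hcut, hnadj, hadj⟩ := hc x y (Subtype.coe_injective.ne hxy)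
  have rainbow_preimage {T : Set V} (hT : RainbowSet c T) :
      RainbowSet (fun v : H.verts => c v) (Subtype.val ⁻¹' T) :=
    fun a ha b hb h => Subtype.ext (hT ha hb h)
  let f : H.coe.deleteEdges {s(x, y)} →g G.deleteEdges {s((x : V), (y : V))} :=
    { toFun := Subtype.val
      map_rel' := by
        intro a b h
        rw [deleteEdges_adj] at h ⊢
        refine ⟨h.1.adj_sub, fun hab => h.2 ?_⟩
        simpa [Subtype.ext_iff] using hab }
  refine ⟨Subtype.val ⁻¹' S, hxS, hyS, fun p => ?_, fun _ => ?_, fun h => ?_⟩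
  · obtain ⟨v, hv, hvS⟩ := hcut (p.map f)
    rw [Walk.support_map, List.mem_map] at hv
    obtain ⟨w, hw, rfl⟩ := hv
    exact ⟨w, hw, hvS⟩
  · apply rainbow_preimage
    by_cases h : G.Adj x y
    · exact (hadj h).elim (fun h => h.mono (Set.subset_insert _ _))
        (fun h => h.mono (Set.subset_insert _ _))
    · exact hnadj h
  · have insert_subset (z : H.verts) :
        insert z (Subtype.val ⁻¹' S) ⊆ Subtype.val ⁻¹' (insert (z : V) S) := by
      rintro w (rfl | hw)
      · exact Or.inl rfl
      · exact Or.inr hw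
    exact (hadj h.adj_sub).imp
      (fun h => (rainbow_preimage h).mono (insert_subset x))
      (fun h => (rainbow_preimage h).mono (insert_subset y))

/-- If `G` is a nontrivial connected graph and `H` is a nontrivial connected
subgraph of `G`, then `rvd H ≤ rvd G`. -/
theorem stmt0 {V : Type*} [Fintype V] (G : SimpleGraph V) (hG : G.Connected)
    (hn : 2 ≤ Fintype.card V) (H : G.Subgraph) (hH : H.coe.Connected)
    (hHn : 2 ≤ H.verts.ncard) :
    rvd H.coe ≤ rvd G := by
  have hne : {k | ∃ c : V → ℕ, IsRVDColoring G c ∧ (Set.range c).ncard = k}.Nonempty :=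
    ⟨_, fun v => Fintype.equivFin V v,
      .of_injective G (Fin.val_injective.comp (Fintype.equivFin V).injective), rfl⟩
  obtain ⟨c, hc, hcard⟩ := Nat.sInf_mem hne
  calc rvd H.coe ≤ (Set.range fun v : H.verts => c v).ncard :=
        Nat.sInf_le ⟨_, hc.subgraph H, rfl⟩
    _ ≤ (Set.range c).ncard :=
        Set.ncard_le_ncard (Set.range_comp_subset_range Subtype.val c) (Set.finite_range c)
    _ = rvd G := hcard
end

section
/- Let G be a nontrivial connected graph, and let u and v be two distinct vertices of G having at least two common neighbors. Then u and v receive different colors in any rainbow vertex-disconnection coloring of G. -/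
open SimpleGraph

/-- `u` and `v` have at least two common neighbors in `G`. -/
def TwoCommonNbrs {V : Type*} (G : SimpleGraph V) (u v : V) : Prop :=
  ∃ w₁ w₂ : V, w₁ ≠ w₂ ∧ G.Adj u w₁ ∧ G.Adj v w₁ ∧ G.Adj u w₂ ∧ G.Adj v w₂

theorem mem_cut_of_common_neighbor {V : Type*} {G : SimpleGraph V} {x y a : V} {S : Set V}
    (hxa : G.Adj x a) (hay : G.Adj a y) (hx : x ∉ S) (hy : y ∉ S)
    (hS : ∀ p : (G.deleteEdges {s(x, y)}).Walk x y, ∃ v ∈ p.support, v ∈ S) : a ∈ S := by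
  have h₁ : (G.deleteEdges {s(x, y)}).Adj x a := by
    have := hxa.ne
    have := hay.ne
    simp only [SimpleGraph.deleteEdges_adj, Set.mem_singleton_iff, Sym2.eq_iff]
    grind
  have h₂ : (G.deleteEdges {s(x, y)}).Adj a y := by
    have := hxa.ne
    have := hay.ne
    simp only [SimpleGraph.deleteEdges_adj, Set.mem_singleton_iff, Sym2.eq_iff]
    grind
  obtain ⟨v, hv, hvS⟩ := hS (.cons h₁ (.cons h₂ .nil))
  simp only [SimpleGraph.Walk.support_cons, SimpleGraph.Walk.support_nil, List.mem_cons,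
    List.not_mem_nil, or_false] at hv
  rcases hv with rfl | rfl | rfl
  · exact absurd hvS hx
  · exact hvS
  · exact absurd hvS hy

theorem IsRVDColoring.exists_rainbow_cut {V : Type*} {G : SimpleGraph V} {c : V → ℕ}
    (hc : IsRVDColoring G c) {x y : V} (hxy : x ≠ y) :
    ∃ S : Set V, x ∉ S ∧ y ∉ S ∧
      (∀ p : (G.deleteEdges {s(x, y)}).Walk x y, ∃ v ∈ p.support, v ∈ S) ∧ RainbowSet c S := by
  obtain ⟨S, hx, hy, hS, hnonadj, hadj⟩ := hc x y hxy
  refine ⟨S, hx, hy, hS, ?_⟩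
  by_cases h : G.Adj x y
  · rcases hadj h with hr | hr
    · exact Set.InjOn.mono (Set.subset_insert x S) hr
    · exact Set.InjOn.mono (Set.subset_insert y S) hr
  · exact hnonadj h

/-- If two distinct vertices `u, v` of a nontrivial connected graph `G` have at least
two common neighbors, then they receive different colors in any rainbow
vertex-disconnection coloring of `G`. -/
theorem stmt2 {V : Type*} [Fintype V] (G : SimpleGraph V) (hG : G.Connected)
    (hn : 2 ≤ Fintype.card V) (u v : V) (huv : u ≠ v) (h : TwoCommonNbrs G u v)
    (c : V → ℕ) (hc : IsRVDColoring G c) :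
    c u ≠ c v := by
  obtain ⟨w₁, w₂, hw, hu₁, hv₁, hu₂, hv₂⟩ := h
  obtain ⟨S, h₁, h₂, hS, hrainbow⟩ := hc.exists_rainbow_cut hw
  exact fun hcuv => huv (hrainbow
    (mem_cut_of_common_neighbor hu₁.symm hu₂ h₁ h₂ hS)
    (mem_cut_of_common_neighbor hv₁.symm hv₂ h₁ h₂ hS) hcuv)
end

section
/- For the complete graph K_n on n ≥ 2 vertices, rvd(K_n) = n − 1 if n = 2 or n = 3, and rvd(K_n) = n if n ≥ 4. -/
open SimpleGraph

/-- In a complete graph, an `x`-`y` vertex-cut contains every vertex other than `x` and `y`, so being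
a rainbow vertex-disconnection coloring means being injective away from one vertex of each pair. -/
theorem isRVDColoring_top_iff {V : Type*} {c : V → ℕ} :
    IsRVDColoring (⊤ : SimpleGraph V) c ↔
      ∀ x y : V, x ≠ y → Set.InjOn c {y}ᶜ ∨ Set.InjOn c {x}ᶜ := by
  refine forall₃_congr fun x y hxy => ⟨?_, fun h => ?_⟩
  · rintro ⟨S, hx, hy, hcut, -, hS⟩
    have hmem : ∀ v, v ≠ x → v ≠ y → v ∈ S := by
      intro v hvx hvy
      have hxv : ((⊤ : SimpleGraph V).deleteEdges {s(x, y)}).Adj x v := by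
        simp [SimpleGraph.deleteEdges_adj, hvx.symm, hvy, hxy]
      have hvy' : ((⊤ : SimpleGraph V).deleteEdges {s(x, y)}).Adj v y := by
        simp [SimpleGraph.deleteEdges_adj, hvx, hvy]
      obtain ⟨w, hw, hwS⟩ := hcut (.cons hxv (.cons hvy' .nil))
      simp only [SimpleGraph.Walk.support_cons, SimpleGraph.Walk.support_nil, List.mem_cons,
        List.not_mem_nil, or_false] at hw
      rcases hw with rfl | rfl | rfl
      · exact absurd hwS hx
      · exact hwS
      · exact absurd hwS hy
    refine (hS hxy).imp (fun h => h.mono fun v hv => ?_) (fun h => h.mono fun v hv => ?_)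
    · by_cases hvx : v = x
      · exact .inl hvx
      · exact .inr (hmem v hvx hv)
    · by_cases hvy : v = y
      · exact .inl hvy
      · exact .inr (hmem v hv hvy)
  · refine ⟨{x, y}ᶜ, by simp, by simp, fun p => ?_, fun h => absurd hxy h, fun _ => ?_⟩
    · cases p with
      | nil => exact absurd rfl hxy
      | @cons _ v _ hadj q =>
        refine ⟨v, by simp, ?_⟩
        simp only [SimpleGraph.deleteEdges_adj, SimpleGraph.top_adj, Set.mem_singleton_iff] at hadj
        rintro (rfl | rfl)
        · exact hadj.1 rfl
        · exact hadj.2 rfl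
    · refine h.imp (fun h => h.mono ?_) (fun h => h.mono ?_)
      · rintro v (rfl | hv)
        · exact hxy
        · exact fun hvy => hv (.inr hvy)
      · rintro v (rfl | hv)
        · exact hxy.symm
        · exact fun hvx => hv (.inl hvx)

theorem isRVDColoring_top_of_injective {V : Type*} {c : V → ℕ} (hc : c.Injective) :
    IsRVDColoring (⊤ : SimpleGraph V) c :=
  isRVDColoring_top_iff.2 fun _ _ _ => .inl hc.injOn

theorem IsRVDColoring.injective_of_top {n : ℕ} (hn : 4 ≤ n) {c : Fin n → ℕ}
    (hc : IsRVDColoring (⊤ : SimpleGraph (Fin n)) c) : c.Injective := by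
  intro a b hab
  by_contra hne
  have hcard : 1 < (({a, b} : Finset (Fin n))ᶜ).card := by
    rw [Finset.card_compl, Fintype.card_fin, Finset.card_pair hne]
    lia
  obtain ⟨x, hx, y, hy, hxy⟩ := Finset.one_lt_card.1 hcard
  simp only [Finset.mem_compl, Finset.mem_insert, Finset.mem_singleton, not_or] at hx hy
  rcases isRVDColoring_top_iff.1 hc x y hxy with h | h
  · exact hne (h (Ne.symm hy.1) (Ne.symm hy.2) hab)
  · exact hne (h (Ne.symm hx.1) (Ne.symm hx.2) hab)

theorem IsRVDColoring.le_ncard_range_of_top {n : ℕ} (hn : 2 ≤ n) {c : Fin n → ℕ}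
    (hc : IsRVDColoring (⊤ : SimpleGraph (Fin n)) c) : n - 1 ≤ (Set.range c).ncard := by
  have key : ∀ z : Fin n, Set.InjOn c {z}ᶜ → n - 1 ≤ (Set.range c).ncard := by
    intro z hz
    have hcompl : ({z}ᶜ : Set (Fin n)).ncard = n - 1 := by
      rw [Set.ncard_compl, Set.ncard_singleton, Nat.card_fin]
    rw [← hcompl, ← hz.ncard_image]
    exact Set.ncard_le_ncard (Set.image_subset_range _ _) (Set.finite_range c)
  rcases isRVDColoring_top_iff.1 hc ⟨0, by lia⟩ ⟨1, by lia⟩ (by simp) with h | h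
  exacts [key _ h, key _ h]

/-- Giving vertices `0` and `1` the same color works as long as every pair of vertices meets
`{0, 1}`. -/
theorem isRVDColoring_top_pred {n : ℕ} (hn : n ≤ 3) :
    IsRVDColoring (⊤ : SimpleGraph (Fin n)) (fun v => (v : ℕ) - 1) := by
  rw [isRVDColoring_top_iff]
  intro x y hxy
  have inj : ∀ z : Fin n, (z : ℕ) ≤ 1 → Set.InjOn (fun v : Fin n => (v : ℕ) - 1) {z}ᶜ := by
    intro z hz a ha b hb hab
    simp only [Set.mem_compl_iff, Set.mem_singleton_iff, Fin.ext_iff] at ha hb hab ⊢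
    lia
  rw [Ne, Fin.ext_iff] at hxy
  by_cases hy : (y : ℕ) ≤ 1
  · exact .inl (inj y hy)
  · exact .inr (inj x (by lia))

theorem ncard_range_fin_pred {n : ℕ} (hn : 2 ≤ n) :
    (Set.range fun v : Fin n => (v : ℕ) - 1).ncard = n - 1 := by
  have : (Set.range fun v : Fin n => (v : ℕ) - 1) = Set.Iio (n - 1) := by
    ext k
    simp only [Set.mem_range, Set.mem_Iio]
    constructor
    · rintro ⟨v, rfl⟩
      lia
    · intro hk
      exact ⟨⟨k + 1, by lia⟩, by simp⟩
  rw [this, ← Finset.coe_Iio, Set.ncard_coe_finset, Nat.card_Iio]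

theorem ncard_range_of_injective_fin {n : ℕ} {c : Fin n → ℕ} (hc : c.Injective) :
    (Set.range c).ncard = n := by
  rw [← Set.image_univ, Set.ncard_image_of_injective _ hc, Set.ncard_univ, Nat.card_fin]

/-- For the complete graph `K n` with `n ≥ 2`: `rvd (K n) = n - 1` if `n = 2` or
`n = 3`, and `rvd (K n) = n` if `n ≥ 4`. -/
theorem stmt3 (n : ℕ) (hn : 2 ≤ n) :
    ((n = 2 ∨ n = 3) → rvd (⊤ : SimpleGraph (Fin n)) = n - 1) ∧
    (4 ≤ n → rvd (⊤ : SimpleGraph (Fin n)) = n) := by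
  refine ⟨fun h => IsLeast.csInf_eq ⟨?_, ?_⟩, fun h => IsLeast.csInf_eq ⟨?_, ?_⟩⟩
  · exact ⟨_, isRVDColoring_top_pred (by lia), ncard_range_fin_pred hn⟩
  · rintro _ ⟨c, hc, rfl⟩
    exact hc.le_ncard_range_of_top hn
  · exact ⟨_, isRVDColoring_top_of_injective Fin.val_injective,
      ncard_range_of_injective_fin Fin.val_injective⟩
  · rintro _ ⟨c, hc, rfl⟩
    exact (ncard_range_of_injective_fin (hc.injective_of_top h)).ge
end

section
/- Let G be a nontrivial connected graph. Then rvd(G) = 1 if and only if G is a tree. -/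
open SimpleGraph

/-- A graph with a rainbow vertex-disconnection coloring using a single color is acyclic. -/
lemma IsRVDColoring.isAcyclic {V : Type*} {G : SimpleGraph V} {c : V → ℕ}
    (hc : IsRVDColoring G c) (hconst : ∀ u v, c u = c v) : G.IsAcyclic := by
  rw [isAcyclic_iff_forall_adj_isBridge]
  intro x y hxy
  rw [isBridge_iff]
  rintro ⟨p⟩
  obtain ⟨S, hx, hy, hS, -, hr⟩ := hc x y hxy.ne
  obtain ⟨v, -, hv⟩ := hS p
  rcases hr hxy with h | h
  · exact hx (h (Set.mem_insert_of_mem x hv) (Set.mem_insert x S) (hconst v x) ▸ hv)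
  · exact hy (h (Set.mem_insert_of_mem y hv) (Set.mem_insert y S) (hconst v y) ▸ hv)

/-- Every coloring of a tree is a rainbow vertex-disconnection coloring. -/
lemma SimpleGraph.IsTree.isRVDColoring {V : Type*} {G : SimpleGraph V} (hG : G.IsTree)
    (c : V → ℕ) : IsRVDColoring G c := by
  classical
  intro x y hne
  by_cases hxy : G.Adj x y
  · refine ⟨∅, by simp, by simp, fun p => ?_, fun h => absurd hxy h, fun _ => ?_⟩
    · have hb := isAcyclic_iff_forall_adj_isBridge.mp hG.isAcyclic hxy
      rw [isBridge_iff] at hb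
      exact absurd ⟨p⟩ hb
    · left
      simp [RainbowSet]
  · obtain ⟨q, hq⟩ := hG.connected.exists_isPath x y
    have hnil : ¬ q.Nil := Walk.not_nil_of_ne hne
    have hadj : G.Adj x q.snd := q.adj_snd hnil
    refine ⟨{q.snd}, ?_, ?_, fun p => ?_, fun _ => ?_, fun h => absurd h hxy⟩
    · simpa using hadj.ne
    · intro hy
      rw [← Set.mem_singleton_iff.mp hy] at hadj
      exact hxy hadj
    · refine ⟨q.snd, ?_, rfl⟩
      let p' : G.Walk x y := p.mapLe (deleteEdges_le _)
      have heq : p'.bypass = q :=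
        congrArg Subtype.val ((hG.isAcyclic.subsingleton_path x y).elim
          ⟨_, p'.bypass_isPath⟩ ⟨q, hq⟩)
      have hmem : q.snd ∈ p'.bypass.support := by
        rw [heq]
        exact q.getVert_mem_support 1
      simpa [p'] using p'.support_bypass_subset_support hmem
    · simp [RainbowSet]

/-- For a nontrivial connected graph `G`, `rvd G = 1` if and only if `G` is a tree. -/
theorem stmt5 {V : Type*} [Fintype V] (G : SimpleGraph V) (hG : G.Connected)
    (hn : 2 ≤ Fintype.card V) :
    rvd G = 1 ↔ G.IsTree := by
  constructor
  · intro h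
    obtain ⟨c, hc, hcard⟩ : (1 : ℕ) ∈ {k | ∃ c : V → ℕ, IsRVDColoring G c ∧
        (Set.range c).ncard = k} := h ▸ Nat.sInf_mem (Nat.nonempty_of_pos_sInf (by
          change 0 < rvd G
          omega))
    refine ⟨hG, hc.isAcyclic fun u v => ?_⟩
    obtain ⟨a, ha⟩ := Set.ncard_eq_one.mp hcard
    have hmem : ∀ u, c u = a := fun u => by simpa [ha] using Set.mem_range_self (f := c) u
    rw [hmem u, hmem v]
  · intro hT
    have : Nonempty V := hG.nonempty
    refine IsLeast.csInf_eq ⟨⟨fun _ => 0, hT.isRVDColoring _, by simp⟩, ?_⟩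
    rintro k ⟨c, -, rfl⟩
    exact (Set.ncard_pos (Set.finite_range c)).mpr (Set.range_nonempty c)
end

section
/- If C_n is a cycle of order n ≥ 3, then rvd(C_n) = 2. -/
open SimpleGraph

theorem SimpleGraph.Walk.exists_mem_support_of_boundary_subset {V : Type*} {H : SimpleGraph V}
    {P S : Set V} (hS : ∀ u v, H.Adj u v → u ∈ P → v ∉ P → v ∈ S) {x y : V} (p : H.Walk x y)
    (hx : x ∈ P) (hy : y ∉ P) : ∃ v ∈ p.support, v ∈ S := by
  obtain ⟨d, hd, h₁, h₂⟩ := p.exists_boundary_dart P hx hy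
  exact ⟨d.snd, p.dart_snd_mem_support_of_mem_darts hd, hS _ _ d.adj h₁ h₂⟩

theorem SimpleGraph.cycleGraph_adj_iff_val {n : ℕ} (hn : 3 ≤ n) (u v : Fin n) :
    (cycleGraph n).Adj u v ↔ u.val + 1 = v.val ∨ v.val + 1 = u.val ∨
      (u.val = 0 ∧ v.val + 1 = n) ∨ (v.val = 0 ∧ u.val + 1 = n) := by
  have hu := u.isLt
  have hv := v.isLt
  rw [cycleGraph_adj']
  rcases le_total u v with h | h
  · rcases h.eq_or_lt with rfl | h'
    · have : (u - u).val = 0 := by rw [Fin.coe_sub_iff_le.2 le_rfl]; omega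
      omega
    · rw [Fin.coe_sub_iff_le.2 h, Fin.coe_sub_iff_lt.2 h']
      have : u.val < v.val := h'
      omega
  · rcases h.eq_or_lt with rfl | h'
    · have : (v - v).val = 0 := by rw [Fin.coe_sub_iff_le.2 le_rfl]; omega
      omega
    · rw [Fin.coe_sub_iff_le.2 h, Fin.coe_sub_iff_lt.2 h']
      have : v.val < u.val := h'
      omega

theorem rainbowSet_pair {V : Type*} {c : V → ℕ} {a b : V} (h : c a ≠ c b) :
    RainbowSet c {a, b} := by
  rintro u (rfl | rfl) v (rfl | rfl) huv
  exacts [rfl, (h huv).elim, (h huv.symm).elim, rfl]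

theorem isRVDColoring_of_lt {V : Type*} [LinearOrder V] {G : SimpleGraph V} {c : V → ℕ}
    (h : ∀ x y : V, x < y → ∃ S : Set V, x ∉ S ∧ y ∉ S ∧
      (∀ p : (G.deleteEdges {s(x, y)}).Walk x y, ∃ v ∈ p.support, v ∈ S) ∧
      (¬ G.Adj x y → RainbowSet c S) ∧
      (G.Adj x y → (RainbowSet c (insert x S) ∨ RainbowSet c (insert y S)))) :
    IsRVDColoring G c := by
  intro x y hxy
  rcases hxy.lt_or_gt with hlt | hlt
  · exact h x y hlt
  · obtain ⟨S, hy, hx, hw, hn, ha⟩ := h y x hlt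
    refine ⟨S, hx, hy, fun p ↦ ?_, fun h ↦ hn fun h' ↦ h h'.symm, fun h ↦ (ha h.symm).symm⟩
    obtain ⟨v, hv, hvS⟩ := hw (p.reverse.mapLe (by rw [Sym2.eq_swap]))
    exact ⟨v, by simpa using hv, hvS⟩

/-- The coloring of `Fin n` giving one color to `0` and `1`, and another to all other vertices. -/
def initialPairColoring (n : ℕ) (v : Fin n) : ℕ := if v.val ≤ 1 then 0 else 1

theorem isRVDColoring_initialPairColoring {n : ℕ} (hn : 3 ≤ n) :
    IsRVDColoring (cycleGraph n) (initialPairColoring n) := by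
  refine isRVDColoring_of_lt fun x y hlt ↦ ?_
  have hlt' : x.val < y.val := hlt
  have hy := y.isLt
  have cut (P S : Set (Fin n)) (hx : x ∈ P) (hy : y ∉ P)
      (hS : ∀ u v : Fin n, (cycleGraph n).Adj u v → ¬ (u = x ∧ v = y) → u ∈ P → v ∉ P → v ∈ S)
      (p : ((cycleGraph n).deleteEdges {s(x, y)}).Walk x y) : ∃ v ∈ p.support, v ∈ S := by
    refine p.exists_mem_support_of_boundary_subset (fun u v huv ↦ ?_) hx hy
    rw [deleteEdges_adj] at huv
    refine hS u v huv.1 ?_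
    rintro ⟨rfl, rfl⟩
    exact huv.2 rfl
  simp only [cycleGraph_adj_iff_val hn, Fin.ext_iff] at cut ⊢
  by_cases hadj : x.val + 1 = y.val ∨ (x.val = 0 ∧ y.val + 1 = n)
  · obtain ⟨z, P, hzx, hzy, hc, hxP, hyP, hS⟩ : ∃ (z : Fin n) (P : Set (Fin n)), x ≠ z ∧ y ≠ z ∧
        (initialPairColoring n x ≠ initialPairColoring n z ∨
          initialPairColoring n y ≠ initialPairColoring n z) ∧ x ∈ P ∧ y ∉ P ∧
        ∀ u v : Fin n, (u.val + 1 = v.val ∨ v.val + 1 = u.val ∨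
          (u.val = 0 ∧ v.val + 1 = n) ∨ (v.val = 0 ∧ u.val + 1 = n)) →
          ¬ (u.val = x.val ∧ v.val = y.val) → u ∈ P → v ∉ P → v ∈ ({z} : Set (Fin n)) := by
      simp only [initialPairColoring, Set.mem_singleton_iff, Fin.ext_iff, ne_eq]
      by_cases hx0 : x.val = 0
      · by_cases hy1 : y.val = 1
        · refine ⟨⟨2, by omega⟩, {v | v.val = 0 ∨ 2 < v.val}, ?_⟩
          simp only [Set.mem_ofPred_eq]
          grind
        · refine ⟨⟨1, by omega⟩, {v | v.val = 0}, ?_⟩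
          simp only [Set.mem_ofPred_eq]
          grind
      · refine ⟨⟨0, by omega⟩, {v | 0 < v.val ∧ v.val ≤ x.val}, ?_⟩
        simp only [Set.mem_ofPred_eq]
        grind
    exact ⟨{z}, hzx, hzy, cut P {z} hxP hyP hS, fun h ↦ by omega,
      fun _ ↦ hc.imp rainbowSet_pair rainbowSet_pair⟩
  · obtain ⟨a, b, P, hx, hy, hc, hxP, hyP, hS⟩ : ∃ (a b : Fin n) (P : Set (Fin n)),
        x ∉ ({a, b} : Set (Fin n)) ∧ y ∉ ({a, b} : Set (Fin n)) ∧
        initialPairColoring n a ≠ initialPairColoring n b ∧ x ∈ P ∧ y ∉ P ∧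
        ∀ u v : Fin n, (u.val + 1 = v.val ∨ v.val + 1 = u.val ∨
          (u.val = 0 ∧ v.val + 1 = n) ∨ (v.val = 0 ∧ u.val + 1 = n)) →
          ¬ (u.val = x.val ∧ v.val = y.val) → u ∈ P → v ∉ P → v ∈ ({a, b} : Set (Fin n)) := by
      simp only [initialPairColoring, Set.mem_insert_iff, Set.mem_singleton_iff, Fin.ext_iff, ne_eq]
      by_cases hx0 : x.val = 0
      · refine ⟨⟨1, by omega⟩, ⟨n - 1, by omega⟩, {v | v.val = 0}, ?_⟩
        simp only [Set.mem_ofPred_eq]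
        grind
      · refine ⟨⟨0, by omega⟩, ⟨x.val + 1, by omega⟩, {v | 0 < v.val ∧ v.val ≤ x.val}, ?_⟩
        simp only [Set.mem_ofPred_eq]
        grind
    exact ⟨{a, b}, hx, hy, cut P _ hxP hyP hS, fun _ ↦ rainbowSet_pair hc, fun h ↦ by omega⟩

theorem ncard_range_initialPairColoring {n : ℕ} (hn : 3 ≤ n) :
    (Set.range (initialPairColoring n)).ncard = 2 := by
  have : Set.range (initialPairColoring n) = {0, 1} := by
    ext k
    constructor
    · rintro ⟨v, rfl⟩
      by_cases h : v.val ≤ 1 <;> simp [initialPairColoring, h]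
    · rintro (rfl | rfl)
      · exact ⟨⟨0, by omega⟩, by simp [initialPairColoring]⟩
      · exact ⟨⟨2, by omega⟩, by simp [initialPairColoring]⟩
  rw [this, Set.ncard_pair zero_ne_one]

theorem SimpleGraph.cycleGraph_reachable_deleteEdges {n : ℕ} (hn : 3 ≤ n) :
    ((cycleGraph n).deleteEdges {s(⟨0, by omega⟩, ⟨1, by omega⟩)}).Reachable
      ⟨0, by omega⟩ ⟨1, by omega⟩ := by
  have key (k : ℕ) (hk : k + 1 < n) :
      ((cycleGraph n).deleteEdges {s(⟨0, by omega⟩, ⟨1, by omega⟩)}).Reachable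
        ⟨k + 1, hk⟩ ⟨1, by omega⟩ := by
    induction k with
    | zero => rfl
    | succ k ih =>
      refine Reachable.trans (Adj.reachable ?_) (ih (by omega))
      simp [deleteEdges_adj, cycleGraph_adj_iff_val hn]
  refine Reachable.trans (Adj.reachable ?_) (key (n - 2) (by omega))
  simp [deleteEdges_adj, cycleGraph_adj_iff_val hn]
  omega

theorem IsRVDColoring.nontrivial_range {V : Type*} {G : SimpleGraph V} {c : V → ℕ}
    (hc : IsRVDColoring G c) {x y : V} (hadj : G.Adj x y)
    (hr : (G.deleteEdges {s(x, y)}).Reachable x y) : (Set.range c).Nontrivial := by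
  obtain ⟨S, hx, hy, hw, -, hS⟩ := hc x y hadj.ne
  obtain ⟨p⟩ := hr
  obtain ⟨v, -, hv⟩ := hw p
  have aux {u : V} (hu : u ∉ S) (h : RainbowSet c (insert u S)) : (Set.range c).Nontrivial :=
    ⟨c u, ⟨u, rfl⟩, c v, ⟨v, rfl⟩, fun huv ↦
      hu (h (Set.mem_insert u S) (Set.mem_insert_of_mem u hv) huv ▸ hv)⟩
  exact (hS hadj).elim (aux hx) (aux hy)

/-- If `C n` is a cycle of order `n ≥ 3`, then `rvd (C n) = 2`. -/
theorem stmt6 (n : ℕ) (hn : 3 ≤ n) :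
    rvd (SimpleGraph.cycleGraph n) = 2 := by
  have hmem : 2 ∈ {k | ∃ c : Fin n → ℕ, IsRVDColoring (cycleGraph n) c ∧
      (Set.range c).ncard = k} :=
    ⟨_, isRVDColoring_initialPairColoring hn, ncard_range_initialPairColoring hn⟩
  refine le_antisymm (Nat.sInf_le hmem) (le_csInf ⟨2, hmem⟩ ?_)
  rintro k ⟨c, hc, rfl⟩
  have hadj : (cycleGraph n).Adj ⟨0, by omega⟩ ⟨1, by omega⟩ := by
    simp [cycleGraph_adj_iff_val hn]
  exact (Set.one_lt_ncard (Set.finite_range c)).2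
    (hc.nontrivial_range hadj (cycleGraph_reachable_deleteEdges hn))
end

section
/- Let G be a nontrivial connected graph. Then rvd(G) = 2 if and only if each block of G is either a K_2 or a cycle and at least one block of G is a cycle. -/
open SimpleGraph

/-- `H` has a cut vertex: a vertex `v` whose removal separates two vertices that
were connected in `H`. -/
def HasCutVertex {W : Type*} (H : SimpleGraph W) : Prop :=
  ∃ (v x y : W), x ≠ v ∧ y ≠ v ∧ H.Reachable x y ∧ ∀ p : H.Walk x y, v ∈ p.support

/-- `B` is a block of `G`: a maximal subgraph of `G` that is connected and has
no cut vertex. -/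
def IsBlock {V : Type*} (G : SimpleGraph V) (B : G.Subgraph) : Prop :=
  B.coe.Connected ∧ ¬ HasCutVertex B.coe ∧
    ∀ B' : G.Subgraph, B ≤ B' → B'.coe.Connected → ¬ HasCutVertex B'.coe → B' = B

namespace SimpleGraph

variable {V : Type*} {G : SimpleGraph V}

theorem Walk.IsPath.exists_append {x y u : V} {p : G.Walk x y} (hp : p.IsPath)
    (hu : u ∈ p.support) :
    ∃ (q : G.Walk x u) (r : G.Walk u y), p = q.append r ∧
      ∀ v ∈ q.support, v ∈ r.support → v = u := by
  classical
  refine ⟨p.takeUntil u hu, p.dropUntil u hu, (p.take_spec hu).symm, ?_⟩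
  intro v hq hr
  rw [← p.take_spec hu, Walk.isPath_def, Walk.support_append, List.nodup_append] at hp
  rw [← Walk.cons_tail_support, List.mem_cons] at hr
  rcases hr with h | h
  · exact h
  · exact absurd rfl (hp.2.2 v hq v h)

theorem Walk.reachable_deleteIncidenceSet {H : SimpleGraph V} {x y v : V} (p : G.Walk x y)
    (hH : ∀ a b, p.toSubgraph.Adj a b → H.Adj a b) (hv : v ∉ p.support) :
    (H.deleteIncidenceSet v).Reachable x y := by
  induction p with
  | nil => exact Reachable.refl _
  | @cons a b c h q ih =>
    simp only [Walk.support_cons, List.mem_cons, not_or] at hv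
    refine Reachable.trans (Adj.reachable ?_) (ih (fun a b hab => hH a b ?_) hv.2)
    · rw [deleteIncidenceSet_adj]
      refine ⟨hH a b (by simp), Ne.symm hv.1, ?_⟩
      rintro rfl
      exact hv.2 q.start_mem_support
    · simp only [Walk.toSubgraph, Subgraph.sup_adj]
      exact Or.inr hab

theorem Walk.notMem_support_of_deleteIncidenceSet {x y v : V}
    (p : (G.deleteIncidenceSet v).Walk x y) (hx : x ≠ v) : v ∉ p.support := by
  induction p with
  | nil => simpa using hx.symm
  | cons h q ih =>
    rw [deleteIncidenceSet_adj] at h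
    simp [ih h.2.2, hx.symm]

/-- The walk ends at the first vertex of `T` that it meets. -/
theorem Walk.exists_first_hit {x y : V} (p : G.Walk x y) (T : Set V) (hy : y ∈ T) :
    ∃ z ∈ T, ∃ q : G.Walk x z, ∀ w ∈ q.support, w ∈ T → w = z := by
  induction p with
  | nil => exact ⟨_, hy, Walk.nil, by simp⟩
  | @cons a b c h p ih =>
    by_cases ha : a ∈ T
    · exact ⟨a, ha, Walk.nil, by simp⟩
    · obtain ⟨z, hz, q, hq⟩ := ih hy
      refine ⟨z, hz, q.cons h, fun w hw hwT => ?_⟩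
      rw [Walk.support_cons, List.mem_cons] at hw
      rcases hw with rfl | hw
      · exact absurd hwT ha
      · exact hq w hw hwT

namespace Subgraph

/-- A subgraph that is connected (or empty) and has no cut vertex. -/
structure IsNonseparable (B : G.Subgraph) : Prop where
  reachable : ∀ ⦃x⦄, x ∈ B.verts → ∀ ⦃y⦄, y ∈ B.verts → B.spanningCoe.Reachable x y
  reachable_delete : ∀ v, ∀ ⦃x⦄, x ∈ B.verts → ∀ ⦃y⦄, y ∈ B.verts → x ≠ v → y ≠ v →
    (B.spanningCoe.deleteIncidenceSet v).Reachable x y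

theorem exists_walk_coe {B : G.Subgraph} {x y : V} (p : B.spanningCoe.Walk x y)
    (hx : x ∈ B.verts) (hy : y ∈ B.verts) :
    ∃ q : B.coe.Walk ⟨x, hx⟩ ⟨y, hy⟩, q.support.map Subtype.val = p.support := by
  induction p with
  | nil => exact ⟨Walk.nil, by simp⟩
  | @cons a b c h p ih =>
    have h' : B.Adj a b := h
    obtain ⟨q, hq⟩ := ih (B.edge_vert h'.symm) hy
    exact ⟨Walk.cons (show B.coe.Adj ⟨a, hx⟩ ⟨b, B.edge_vert h'.symm⟩ from h') q, by simp [hq]⟩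

theorem exists_walk_spanningCoe {B : G.Subgraph} {x y : B.verts} (p : B.coe.Walk x y) :
    ∃ q : B.spanningCoe.Walk x y, q.support = p.support.map Subtype.val := by
  induction p with
  | nil => exact ⟨Walk.nil, by simp⟩
  | @cons a b c h p ih =>
    obtain ⟨q, hq⟩ := ih
    exact ⟨Walk.cons (show B.spanningCoe.Adj a b from h) q, by simp [hq]⟩

theorem isNonseparable_iff {B : G.Subgraph} :
    B.coe.Connected ∧ ¬ HasCutVertex B.coe ↔ B.verts.Nonempty ∧ B.IsNonseparable := by
  constructor
  · rintro ⟨hc, hn⟩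
    have hr : ∀ ⦃x⦄, x ∈ B.verts → ∀ ⦃y⦄, y ∈ B.verts → B.spanningCoe.Reachable x y := by
      intro x hx y hy
      obtain ⟨p⟩ := hc.preconnected ⟨x, hx⟩ ⟨y, hy⟩
      exact (exists_walk_spanningCoe p).choose.reachable
    refine ⟨by obtain ⟨⟨x, hx⟩⟩ := hc.nonempty; exact ⟨x, hx⟩, hr, ?_⟩
    intro v x hx y hy hxv hyv
    by_cases hv : v ∈ B.verts
    · by_contra hcon
      refine hn ⟨⟨v, hv⟩, ⟨x, hx⟩, ⟨y, hy⟩, by simpa using hxv, by simpa using hyv,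
        hc.preconnected _ _, fun p => ?_⟩
      by_contra hp
      obtain ⟨q, hq⟩ := exists_walk_spanningCoe p
      refine hcon (q.reachable_deleteIncidenceSet (fun a b h => h.adj_sub) ?_)
      rw [hq]
      simpa [hv] using hp
    · refine (hr hx hy).mono ?_
      intro a b hab
      rw [deleteIncidenceSet_adj]
      have hab' : B.Adj a b := hab
      refine ⟨hab, ?_, ?_⟩
      · rintro rfl; exact hv (B.edge_vert hab')
      · rintro rfl; exact hv (B.edge_vert hab'.symm)
  · rintro ⟨⟨x, hx⟩, h⟩
    refine ⟨?_, ?_⟩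
    · have : Nonempty B.verts := ⟨⟨x, hx⟩⟩
      refine { preconnected := fun a b => ?_ }
      obtain ⟨p⟩ := h.reachable a.2 b.2
      exact (exists_walk_coe p a.2 b.2).choose.reachable
    · rintro ⟨v, a, b, hav, hbv, -, hw⟩
      have hav' : (a : V) ≠ v := fun e => hav (Subtype.ext e)
      obtain ⟨p⟩ := h.reachable_delete v a.2 b.2 hav' (fun e => hbv (Subtype.ext e))
      have hp := p.notMem_support_of_deleteIncidenceSet hav'
      obtain ⟨q, hq⟩ := exists_walk_coe (p.mapLe (deleteIncidenceSet_le _ _)) a.2 b.2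
      apply hp
      have := List.mem_map_of_mem (f := Subtype.val) (hw q)
      rw [hq] at this
      simpa using this

namespace IsNonseparable

theorem sup {B C : G.Subgraph} (hB : B.IsNonseparable) (hC : C.IsNonseparable) {a b : V}
    (hab : a ≠ b) (haB : a ∈ B.verts) (haC : a ∈ C.verts) (hbB : b ∈ B.verts)
    (hbC : b ∈ C.verts) : (B ⊔ C).IsNonseparable := by
  have hl : B.spanningCoe ≤ (B ⊔ C).spanningCoe := fun x y h => Or.inl h
  have hr : C.spanningCoe ≤ (B ⊔ C).spanningCoe := fun x y h => Or.inr h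
  have hdel : ∀ {H K : SimpleGraph V} (v : V), H ≤ K →
      H.deleteIncidenceSet v ≤ K.deleteIncidenceSet v := by
    intro H K v hHK x y h
    rw [deleteIncidenceSet_adj] at h ⊢
    exact ⟨hHK h.1, h.2⟩
  constructor
  · have key : ∀ ⦃x⦄, x ∈ (B ⊔ C).verts → (B ⊔ C).spanningCoe.Reachable x a := by
      rintro x (hx | hx)
      · exact (hB.reachable hx haB).mono hl
      · exact (hC.reachable hx haC).mono hr
    exact fun x hx y hy => (key hx).trans (key hy).symm
  · intro v
    obtain ⟨d, hd, hdB, hdC⟩ : ∃ d, d ≠ v ∧ d ∈ B.verts ∧ d ∈ C.verts := by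
      by_cases h : a = v
      · exact ⟨b, fun e => hab (h.trans e.symm), hbB, hbC⟩
      · exact ⟨a, h, haB, haC⟩
    have key : ∀ ⦃x⦄, x ∈ (B ⊔ C).verts → x ≠ v →
        ((B ⊔ C).spanningCoe.deleteIncidenceSet v).Reachable x d := by
      rintro x (hx | hx) hxv
      · exact (hB.reachable_delete v hx hdB hxv hd).mono (hdel v hl)
      · exact (hC.reachable_delete v hx hdC hxv hd).mono (hdel v hr)
    exact fun x hx y hy hxv hyv => (key hx hxv).trans (key hy hyv).symm

theorem sup_path {B : G.Subgraph} (hB : B.IsNonseparable) {a b : V} (ha : a ∈ B.verts)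
    (hb : b ∈ B.verts) {p : G.Walk a b} (hp : p.IsPath) :
    (B ⊔ p.toSubgraph).IsNonseparable := by
  have hl : B.spanningCoe ≤ (B ⊔ p.toSubgraph).spanningCoe := fun x y h => Or.inl h
  have hdel : ∀ (v : V), B.spanningCoe.deleteIncidenceSet v ≤
      (B ⊔ p.toSubgraph).spanningCoe.deleteIncidenceSet v := by
    intro v x y h
    rw [deleteIncidenceSet_adj] at h ⊢
    exact ⟨hl h.1, h.2⟩
  have key : ∀ v, ∀ ⦃x⦄, x ∈ (B ⊔ p.toSubgraph).verts → x ≠ v → ∃ d ∈ B.verts, d ≠ v ∧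
      ((B ⊔ p.toSubgraph).spanningCoe.deleteIncidenceSet v).Reachable x d := by
    rintro v x (hx | hx) hxv
    · exact ⟨x, hx, hxv, Reachable.refl _⟩
    · obtain ⟨q, r, hqr, hdisj⟩ := hp.exists_append (p.mem_verts_toSubgraph.1 hx)
      have hadj : ∀ x y, q.toSubgraph.Adj x y ∨ r.toSubgraph.Adj x y →
          (B ⊔ p.toSubgraph).spanningCoe.Adj x y := by
        intro x y h
        refine Or.inr ?_
        rw [hqr, Walk.toSubgraph_append]
        exact h
      by_cases hvq : v ∈ q.support
      · have hvr : v ∉ r.support := fun h => hxv (hdisj v hvq h).symm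
        refine ⟨b, hb, ?_, r.reachable_deleteIncidenceSet (fun x y h => hadj x y (Or.inr h)) hvr⟩
        rintro rfl
        exact hvr r.end_mem_support
      · refine ⟨a, ha, ?_,
          (q.reachable_deleteIncidenceSet (fun x y h => hadj x y (Or.inl h)) hvq).symm⟩
        rintro rfl
        exact hvq q.start_mem_support
  constructor
  · have key' : ∀ ⦃x⦄, x ∈ (B ⊔ p.toSubgraph).verts →
        (B ⊔ p.toSubgraph).spanningCoe.Reachable x a := by
      rintro x (hx | hx)
      · exact (hB.reachable hx ha).mono hl
      · by_cases hab : x = a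
        · rw [hab]
        · obtain ⟨d, hd, -, hxd⟩ := key a (Or.inr hx) hab
          exact (hxd.mono (deleteIncidenceSet_le _ _)).trans ((hB.reachable hd ha).mono hl)
    exact fun x hx y hy => (key' hx).trans (key' hy).symm
  · intro v x hx y hy hxv hyv
    obtain ⟨d, hd, hdv, hxd⟩ := key v hx hxv
    obtain ⟨e, he, hev, hye⟩ := key v hy hyv
    exact hxd.trans (((hB.reachable_delete v hd he hdv hev).mono (hdel v)).trans hye.symm)

theorem subgraphOfAdj {a b : V} (h : G.Adj a b) : (G.subgraphOfAdj h).IsNonseparable := by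
  constructor
  · have hab : (G.subgraphOfAdj h).spanningCoe.Reachable a b := Adj.reachable (by simpa using h.ne)
    rintro x (rfl | rfl) y (rfl | rfl)
    exacts [Reachable.refl _, hab, hab.symm, Reachable.refl _]
  · intro v
    by_cases hv : a = v ∨ b = v
    · rintro x (rfl | rfl) y (rfl | rfl) hx hy
      exacts [Reachable.refl _, by tauto, by tauto, Reachable.refl _]
    · have hab : ((G.subgraphOfAdj h).spanningCoe.deleteIncidenceSet v).Reachable a b :=
        Adj.reachable (by rw [deleteIncidenceSet_adj]; simpa [h.ne] using hv)
      rintro x (rfl | rfl) y (rfl | rfl) - -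
      exacts [Reachable.refl _, hab, hab.symm, Reachable.refl _]

/-- Two edges at `v` whose other ends are joined avoiding `v` lie in a common subgraph without
cut vertex. -/
theorem exists_of_reachable {v a b : V} (ha : G.Adj v a) (hb : G.Adj v b)
    (h : (G.deleteIncidenceSet v).Reachable a b) :
    ∃ C : G.Subgraph, C.IsNonseparable ∧ C.Adj v a ∧ C.Adj v b := by
  obtain ⟨p, hp⟩ := h.symm.exists_isPath
  have hv := p.notMem_support_of_deleteIncidenceSet hb.ne'
  have hle := deleteIncidenceSet_le G v
  have hp' : (Walk.cons hb (p.mapLe hle)).IsPath := by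
    rw [Walk.cons_isPath_iff]
    exact ⟨(Walk.isPath_mapLe hle).2 hp, by simpa using hv⟩
  refine ⟨_, (subgraphOfAdj ha).sup_path (by simp) (by simp) hp', Or.inl (by simp), Or.inr ?_⟩
  simp

theorem _root_.IsBlock.isNonseparable {B : G.Subgraph} (hB : IsBlock G B) : B.IsNonseparable :=
  (isNonseparable_iff.1 ⟨hB.1, hB.2.1⟩).2

theorem _root_.IsBlock.nonempty {B : G.Subgraph} (hB : IsBlock G B) : B.verts.Nonempty :=
  (isNonseparable_iff.1 ⟨hB.1, hB.2.1⟩).1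

theorem _root_.IsBlock.eq_of_le {B C : G.Subgraph} (hB : IsBlock G B) (hC : C.IsNonseparable)
    (h : B ≤ C) : C = B := by
  obtain ⟨h1, h2⟩ := isNonseparable_iff.2 ⟨hB.nonempty.mono h.1, hC⟩
  exact hB.2.2 C h h1 h2

theorem exists_isBlock [Finite V] {C : G.Subgraph} (hC : C.IsNonseparable)
    (hne : C.verts.Nonempty) : ∃ B, IsBlock G B ∧ C ≤ B := by
  obtain ⟨B, hCB, hB⟩ := Finite.exists_le_maximal (p := fun B : G.Subgraph =>
    B.coe.Connected ∧ ¬ HasCutVertex B.coe) (isNonseparable_iff.2 ⟨hne, hC⟩)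
  exact ⟨B, ⟨hB.prop.1, hB.prop.2, fun B' hle h1 h2 => (hB.le_of_ge ⟨h1, h2⟩ hle).antisymm hle⟩,
    hCB⟩

end IsNonseparable

end Subgraph

end SimpleGraph

namespace IsBlock

variable {V : Type*} {G : SimpleGraph V} {B C : G.Subgraph}

theorem eq_of_two_verts (hB : IsBlock G B) (hC : IsBlock G C) {a b : V}
    (hab : a ≠ b) (haB : a ∈ B.verts) (haC : a ∈ C.verts) (hbB : b ∈ B.verts)
    (hbC : b ∈ C.verts) : B = C := by
  have h := hB.isNonseparable.sup hC.isNonseparable hab haB haC hbB hbC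
  exact (hB.eq_of_le h le_sup_left).symm.trans (hC.eq_of_le h le_sup_right)

theorem eq_of_reachable_sdiff (hB : IsBlock G B) {a b : V} (ha : a ∈ B.verts)
    (hb : b ∈ B.verts) (h : (G \ B.spanningCoe).Reachable a b) : a = b := by
  obtain ⟨p, hp⟩ := h.exists_isPath
  have hle : G \ B.spanningCoe ≤ G := sdiff_le
  have hsup := hB.eq_of_le
    (hB.isNonseparable.sup_path ha hb ((Walk.isPath_mapLe hle).2 hp)) le_sup_left
  cases p with
  | nil => rfl
  | @cons _ c _ h q =>
    exfalso
    have hadj : (B ⊔ ((Walk.cons h q).mapLe hle).toSubgraph).Adj a c := by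
      refine Or.inr ?_
      simp
    rw [hsup] at hadj
    exact h.2 hadj

theorem adj_of_adj (hB : IsBlock G B) {a b : V} (ha : a ∈ B.verts) (hb : b ∈ B.verts)
    (h : G.Adj a b) : B.Adj a b := by
  by_contra hn
  exact h.ne (hB.eq_of_reachable_sdiff ha hb (Adj.reachable ⟨h, hn⟩))

theorem exists_reachable_sdiff (hB : IsBlock G B) (hG : G.Connected) (v : V) :
    ∃ b ∈ B.verts, (G \ B.spanningCoe).Reachable b v := by
  obtain ⟨b, hb⟩ := hB.nonempty
  obtain ⟨p⟩ := hG.preconnected v b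
  induction p with
  | nil => exact ⟨_, hb, Reachable.refl _⟩
  | @cons x y z h p ih =>
    by_cases hxy : B.Adj x y
    · exact ⟨x, B.edge_vert hxy, Reachable.refl _⟩
    · obtain ⟨d, hd, hr⟩ := ih hb
      refine ⟨d, hd, hr.trans (Adj.reachable ?_)⟩
      exact ⟨h.symm, fun h' => hxy (Subgraph.Adj.symm h')⟩

/-- Every vertex hangs off a unique vertex of the block. -/
theorem exists_proj (hB : IsBlock G B) (hG : G.Connected) :
    ∃ π : V → V, (∀ v, π v ∈ B.verts) ∧ (∀ v ∈ B.verts, π v = v) ∧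
      ∀ u v, (G \ B.spanningCoe).Adj u v → π u = π v := by
  choose π hπ hr using hB.exists_reachable_sdiff hG
  refine ⟨π, hπ, fun v hv => hB.eq_of_reachable_sdiff (hπ v) hv (hr v), fun u v h => ?_⟩
  exact hB.eq_of_reachable_sdiff (hπ u) (hπ v) ((hr u).trans (h.reachable.trans (hr v).symm))

theorem exists_mem_support (hB : IsBlock G B) (hG : G.Connected) {x y : V} (hx : x ∈ B.verts)
    (hy : y ∈ B.verts) (S A : Set V) (hxA : x ∈ A) (hyA : y ∉ A)
    (hA : ∀ a b, B.Adj a b → s(a, b) ≠ s(x, y) → a ∉ S → b ∉ S → a ∈ A → b ∈ A)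
    (p : (G.deleteEdges {s(x, y)}).Walk x y) : ∃ v ∈ p.support, v ∈ S := by
  obtain ⟨π, hπ, hπB, hπD⟩ := hB.exists_proj hG
  by_contra! hcon
  have key : ∀ (u w : V) (q : (G.deleteEdges {s(x, y)}).Walk u w), (∀ v ∈ q.support, v ∉ S) →
      π u ∈ A → π w ∈ A := by
    intro u w q hq hu
    induction q with
    | nil => exact hu
    | @cons a b c h q ih =>
      simp only [Walk.support_cons, List.mem_cons] at hq
      refine ih (fun v hv => hq v (Or.inr hv)) ?_
      rw [deleteEdges_adj] at h
      by_cases hab : B.Adj a b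
      · rw [hπB a (B.edge_vert hab)] at hu
        rw [hπB b (B.edge_vert hab.symm)]
        exact hA a b hab (by simpa using h.2) (hq a (Or.inl rfl))
          (hq b (Or.inr q.start_mem_support)) hu
      · rwa [← hπD a b ⟨h.1, hab⟩]
  have := key x y p hcon (by rwa [hπB x hx])
  rw [hπB y hy] at this
  exact hyA this

end IsBlock

theorem not_injOn_of_ncard_range_le_two {V : Type*} [Finite V] {c : V → ℕ}
    (hc : (Set.range c).ncard ≤ 2) {T : Set V} (hT : Set.InjOn c T) {s t u : V} (hs : s ∈ T)
    (ht : t ∈ T) (hu : u ∈ T) (hst : s ≠ t) (hsu : s ≠ u) (htu : t ≠ u) : False := by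
  have h3 : ({c s, c t, c u} : Set ℕ).ncard = 3 :=
    Set.ncard_eq_three.2 ⟨_, _, _, fun h => hst (hT hs ht h), fun h => hsu (hT hs hu h),
      fun h => htu (hT ht hu h), rfl⟩
  have hle : ({c s, c t, c u} : Set ℕ).ncard ≤ (Set.range c).ncard := by
    refine Set.ncard_le_ncard ?_ (Set.finite_range c)
    rintro _ (rfl | rfl | rfl) <;> exact Set.mem_range_self _
  omega

namespace SimpleGraph

theorem cycleGraph_adj_val {m : ℕ} (hm : 2 ≤ m) (i j : Fin m) :
    (cycleGraph m).Adj i j ↔ i.val + 1 = j.val ∨ j.val + 1 = i.val ∨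
      (i.val = 0 ∧ j.val + 1 = m) ∨ (j.val = 0 ∧ i.val + 1 = m) := by
  have key : ∀ u v : Fin m, (u - v).val = if v.val ≤ u.val then u.val - v.val
      else m - v.val + u.val := by
    intro u v
    rw [Fin.sub_def]
    have hu := u.2
    have hv := v.2
    split_ifs with h
    · rw [show m - v.val + u.val = (u.val - v.val) + m by omega]
      simp only [Nat.add_mod_right]
      exact Nat.mod_eq_of_lt (by omega)
    · exact Nat.mod_eq_of_lt (by omega)
  rw [cycleGraph_adj', key, key]
  have hi := i.2
  have hj := j.2
  split_ifs <;> omega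

namespace Subgraph

variable {V : Type*} {G : SimpleGraph V} {B : G.Subgraph}

/-- In a nonseparable subgraph no vertex has degree three, as it would be the branch vertex of a
theta graph. -/
theorem IsNonseparable.false_of_three_adj [Finite V] (hB : B.IsNonseparable) {c : V → ℕ}
    (hc : IsRVDColoring G c) (hc2 : (Set.range c).ncard ≤ 2) {a b₁ b₂ b₃ : V}
    (h₁ : B.Adj a b₁) (h₂ : B.Adj a b₂) (h₃ : B.Adj a b₃) (h₁₂ : b₁ ≠ b₂) (h₁₃ : b₁ ≠ b₃)
    (h₂₃ : b₂ ≠ b₃) : False := by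
  obtain ⟨p, hp⟩ := (hB.reachable_delete a (B.edge_vert h₁.symm) (B.edge_vert h₂.symm)
    h₁.adj_sub.ne' h₂.adj_sub.ne').exists_isPath
  obtain ⟨r⟩ := hB.reachable_delete a (B.edge_vert h₃.symm) (B.edge_vert h₁.symm) h₃.adj_sub.ne' h₁.adj_sub.ne'
  obtain ⟨y, hy, w₃, hw₃⟩ := r.exists_first_hit {w | w ∈ p.support} p.start_mem_support
  obtain ⟨w₁, w₂, rfl, hw₁₂⟩ := hp.exists_append hy
  have hya : y ≠ a := by
    rintro rfl
    exact (Walk.notMem_support_of_deleteIncidenceSet _ h₁.adj_sub.ne') hy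
  have d₁₂ : ∀ v ∈ w₁.support, v ∈ w₂.reverse.support → v = y :=
    fun v h h' => hw₁₂ v h (by simpa using h')
  have d₁₃ : ∀ v ∈ w₁.support, v ∈ w₃.support → v = y := fun v h h' =>
    hw₃ v h' ((Walk.mem_support_append_iff _ _).2 (Or.inl h))
  have d₂₃ : ∀ v ∈ w₂.reverse.support, v ∈ w₃.support → v = y := fun v h h' =>
    hw₃ v h' ((Walk.mem_support_append_iff _ _).2 (Or.inr (by simpa using h)))
  obtain ⟨S, haS, hyS, hS, hna, had⟩ := hc a y hya.symm
  have hle : B.spanningCoe.deleteIncidenceSet a ≤ G.deleteEdges {s(a, y)} := by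
    intro u v h
    rw [deleteIncidenceSet_adj] at h
    rw [SimpleGraph.deleteEdges_adj]
    refine ⟨h.1.adj_sub, ?_⟩
    rw [Set.mem_singleton_iff, Sym2.eq_iff]
    rintro (⟨h', -⟩ | ⟨-, h'⟩)
    exacts [h.2.1 h', h.2.2 h']
  have meet : ∀ b, B.Adj a b → b ≠ y → ∀ w : (B.spanningCoe.deleteIncidenceSet a).Walk b y,
      ∃ s ∈ S, s ∈ w.support ∧ s ≠ y := by
    intro b hab hby w
    have hadj : (G.deleteEdges {s(a, y)}).Adj a b := by
      rw [SimpleGraph.deleteEdges_adj, Set.mem_singleton_iff, Sym2.eq_iff]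
      refine ⟨hab.adj_sub, ?_⟩
      rintro (⟨-, h'⟩ | ⟨h', -⟩)
      exacts [hby h', hya h'.symm]
    obtain ⟨s, hs, hsS⟩ := hS (Walk.cons hadj (w.mapLe hle))
    rw [Walk.support_cons, List.mem_cons] at hs
    rcases hs with rfl | hs
    · exact absurd hsS haS
    · refine ⟨s, hsS, by simpa using hs, ?_⟩
      rintro rfl
      exact hyS hsS
  by_cases hay : G.Adj a y
  · obtain ⟨z, hz, hT⟩ : ∃ z, z ∉ S ∧ Set.InjOn c (insert z S) := by
      rcases had hay with h | h
      exacts [⟨a, haS, h⟩, ⟨y, hyS, h⟩]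
    have two : ∀ b b', B.Adj a b → B.Adj a b' → b ≠ y → b' ≠ y →
        ∀ (w : (B.spanningCoe.deleteIncidenceSet a).Walk b y)
        (w' : (B.spanningCoe.deleteIncidenceSet a).Walk b' y),
        (∀ v ∈ w.support, v ∈ w'.support → v = y) → False := by
      intro b b' hb hb' hby hby' w w' hww
      obtain ⟨s, hsS, hs, hsy⟩ := meet b hb hby w
      obtain ⟨t, htS, ht, hty⟩ := meet b' hb' hby' w'
      refine not_injOn_of_ncard_range_le_two hc2 hT (Set.mem_insert _ _)
        (Set.mem_insert_of_mem _ hsS) (Set.mem_insert_of_mem _ htS) ?_ ?_ ?_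
      · rintro rfl; exact hz hsS
      · rintro rfl; exact hz htS
      · rintro rfl; exact hsy (hww _ hs ht)
    by_cases e₁ : b₁ = y
    · exact two b₂ b₃ h₂ h₃ (e₁ ▸ h₁₂.symm) (e₁ ▸ h₁₃.symm) _ _ d₂₃
    · by_cases e₂ : b₂ = y
      · exact two b₁ b₃ h₁ h₃ e₁ (e₂ ▸ h₂₃.symm) _ _ d₁₃
      · exact two b₁ b₂ h₁ h₂ e₁ e₂ _ _ d₁₂
  · have hne : ∀ b, B.Adj a b → b ≠ y := by
      rintro b hb rfl
      exact hay hb.adj_sub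
    obtain ⟨s, hsS, hs, hsy⟩ := meet b₁ h₁ (hne _ h₁) w₁
    obtain ⟨t, htS, ht, hty⟩ := meet b₂ h₂ (hne _ h₂) w₂.reverse
    obtain ⟨u, huS, hu, huy⟩ := meet b₃ h₃ (hne _ h₃) w₃
    refine not_injOn_of_ncard_range_le_two hc2 (hna hay) hsS htS huS ?_ ?_ ?_
    · rintro rfl; exact hsy (d₁₂ _ hs ht)
    · rintro rfl; exact hsy (d₁₃ _ hs hu)
    · rintro rfl; exact hty (d₂₃ _ ht hu)

theorem IsNonseparable.exists_iso_cycleGraph (hB : B.IsNonseparable)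
    (h3 : ∀ ⦃a b₁ b₂ b₃⦄, B.Adj a b₁ → B.Adj a b₂ → B.Adj a b₃ → b₁ ≠ b₂ → b₁ = b₃ ∨ b₂ = b₃)
    {x y w : V} (hxy : B.Adj x y) (hxw : B.Adj x w) (hyw : y ≠ w) :
    ∃ m : ℕ, 3 ≤ m ∧ Nonempty (B.coe ≃g cycleGraph m) := by
  obtain ⟨p, hp⟩ := (hB.reachable_delete x (B.edge_vert hxy.symm) (B.edge_vert hxw.symm)
    hxy.adj_sub.ne' hxw.adj_sub.ne').exists_isPath
  have hv := p.notMem_support_of_deleteIncidenceSet hxy.adj_sub.ne'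
  have hle := deleteIncidenceSet_le B.spanningCoe x
  have hxy' : B.spanningCoe.Adj x y := hxy
  obtain ⟨q, hq, hlen⟩ : ∃ q : B.spanningCoe.Walk x w, q.IsPath ∧ 2 ≤ q.length := by
    refine ⟨Walk.cons hxy' (p.mapLe hle), ?_, ?_⟩
    · rw [Walk.cons_isPath_iff]
      exact ⟨(Walk.isPath_mapLe hle).2 hp, by simpa using hv⟩
    · have : p.length ≠ 0 := fun h => hyw (Walk.eq_of_length_eq_zero h)
      rw [Walk.length_cons, Walk.mapLe, Walk.length_map]
      omega
  clear hp hv hle p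
  have hm : 3 ≤ q.length + 1 := by omega
  let f : Fin (q.length + 1) → V := fun i => q.getVert i
  have hinj : Function.Injective f := by
    intro i j hij
    exact Fin.ext (hq.getVert_injOn (Nat.lt_succ_iff.1 i.2) (Nat.lt_succ_iff.1 j.2) hij)
  have hsucc : ∀ i j : Fin (q.length + 1), i.val + 1 = j.val → B.Adj (f i) (f j) := by
    intro i j hij
    have h := q.adj_getVert_succ (i := i.val) (by omega)
    rw [hij] at h
    exact h
  have hlast : ∀ i j : Fin (q.length + 1), i.val = 0 → j.val + 1 = q.length + 1 →
      B.Adj (f i) (f j) := by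
    intro i j hi hj
    have hi' : f i = x := by simp [f, hi]
    have hj' : f j = w := by simp [f, show j.val = q.length by omega]
    rwa [hi', hj']
  have hadj : ∀ i j, (cycleGraph (q.length + 1)).Adj i j → B.Adj (f i) (f j) := by
    intro i j hij
    rw [cycleGraph_adj_val (by omega)] at hij
    rcases hij with h | h | ⟨h, h'⟩ | ⟨h, h'⟩
    exacts [hsucc i j h, (hsucc j i h).symm, hlast i j h h', (hlast j i h h').symm]
  have hnbr : ∀ i v, B.Adj (f i) v → ∃ j, (cycleGraph (q.length + 1)).Adj i j ∧ f j = v := by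
    intro i v hiv
    obtain ⟨j, k, hj, hk, hjk⟩ : ∃ j k, (cycleGraph (q.length + 1)).Adj i j ∧
        (cycleGraph (q.length + 1)).Adj i k ∧ j ≠ k := by
      simp only [cycleGraph_adj_val (show 2 ≤ q.length + 1 by omega), ne_eq, Fin.ext_iff]
      have hi := i.2
      by_cases h0 : i.val = 0
      · exact ⟨⟨1, by omega⟩, ⟨q.length, by omega⟩, by dsimp only; omega, by dsimp only; omega, by dsimp only; omega⟩
      · by_cases hl : i.val = q.length
        · exact ⟨⟨0, by omega⟩, ⟨q.length - 1, by omega⟩, by dsimp only; omega, by dsimp only; omega,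
            by dsimp only; omega⟩
        · exact ⟨⟨i.val + 1, by omega⟩, ⟨i.val - 1, by omega⟩, by dsimp only; omega, by dsimp only; omega,
            by dsimp only; omega⟩
    rcases h3 (hadj i j hj) (hadj i k hk) hiv (fun h => hjk (hinj h)) with h | h
    exacts [⟨j, hj, h⟩, ⟨k, hk, h⟩]
  have hmem : ∀ i, f i ∈ B.verts := by
    intro i
    obtain ⟨j, hj⟩ : ∃ j, (cycleGraph (q.length + 1)).Adj i j := by
      simp only [cycleGraph_adj_val (show 2 ≤ q.length + 1 by omega)]
      have hi := i.2
      by_cases h0 : i.val = 0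
      · exact ⟨⟨1, by omega⟩, by dsimp only; omega⟩
      · exact ⟨⟨i.val - 1, by omega⟩, by dsimp only; omega⟩
    exact B.edge_vert (hadj i j hj)
  have hsurj : ∀ v ∈ B.verts, ∃ i, f i = v := by
    intro v hv
    obtain ⟨r⟩ := hB.reachable (B.edge_vert hxy) hv
    have key : ∀ (a b : V) (r : B.spanningCoe.Walk a b), (∃ i, f i = a) → ∃ i, f i = b := by
      intro a b r
      induction r with
      | nil => exact id
      | cons h r ih =>
        rintro ⟨i, rfl⟩
        obtain ⟨j, -, hj⟩ := hnbr i _ h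
        exact ih ⟨j, hj⟩
    exact key x v r ⟨⟨0, by omega⟩, by simp [f]⟩
  let e : Fin (q.length + 1) ≃ B.verts := Equiv.ofBijective (fun i => ⟨f i, hmem i⟩)
    ⟨fun i j h => hinj (congrArg Subtype.val h), fun v => by
      obtain ⟨i, hi⟩ := hsurj v v.2
      exact ⟨i, Subtype.ext hi⟩⟩
  refine ⟨q.length + 1, hm, ⟨RelIso.symm ⟨e, ?_⟩⟩⟩
  intro i j
  refine ⟨fun h => ?_, fun h => hadj i j h⟩
  obtain ⟨k, hk, hkj⟩ := hnbr i (f j) h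
  rwa [← hinj hkj]

end Subgraph

end SimpleGraph

namespace IsBlock

variable {V : Type*} {G : SimpleGraph V} {B : G.Subgraph}

theorem exists_adj [Nontrivial V] (hB : IsBlock G B) (hG : G.Connected) : ∃ x y, B.Adj x y := by
  obtain ⟨x, hx⟩ := hB.nonempty
  obtain ⟨y, hxy⟩ := hG.preconnected.exists_adj_of_nontrivial x
  by_contra! hcon
  have hyB : y ∉ B.verts := fun hy => hcon _ _ (hB.adj_of_adj hx hy hxy)
  have hle : B ≤ G.subgraphOfAdj hxy := by
    refine ⟨fun z hz => Or.inl ?_, fun a b hab => absurd hab (hcon a b)⟩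
    obtain ⟨p⟩ := hB.isNonseparable.reachable hz hx
    cases p with
    | nil => rfl
    | cons h _ => exact absurd h (hcon _ _)
  rw [← hB.eq_of_le (Subgraph.IsNonseparable.subgraphOfAdj hxy) hle] at hyB
  simp at hyB

theorem iso_top_or_iso_cycleGraph [Finite V] [Nontrivial V] (hB : IsBlock G B)
    (hG : G.Connected) {c : V → ℕ} (hc : IsRVDColoring G c) (hc2 : (Set.range c).ncard ≤ 2) :
    Nonempty (B.coe ≃g (⊤ : SimpleGraph (Fin 2))) ∨
      ∃ m : ℕ, 3 ≤ m ∧ Nonempty (B.coe ≃g SimpleGraph.cycleGraph m) := by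
  have hN := hB.isNonseparable
  obtain ⟨x, y, hxy⟩ := hB.exists_adj hG
  by_cases hv : ∀ v ∈ B.verts, v = x ∨ v = y
  · left
    let f : Fin 2 → B.verts := ![⟨x, B.edge_vert hxy⟩, ⟨y, B.edge_vert hxy.symm⟩]
    have hf : Function.Bijective f := by
      constructor
      · intro i j h
        fin_cases i <;> fin_cases j <;> simp_all [f, hxy.adj_sub.ne, hxy.adj_sub.ne']
      · rintro ⟨v, hvB⟩
        rcases hv v hvB with rfl | rfl
        exacts [⟨0, rfl⟩, ⟨1, rfl⟩]
    refine ⟨RelIso.symm ⟨Equiv.ofBijective f hf, ?_⟩⟩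
    intro i j
    fin_cases i <;> fin_cases j <;> simp [f, hxy, hxy.symm]
  · right
    push Not at hv
    obtain ⟨z, hz, hzx, hzy⟩ := hv
    obtain ⟨p⟩ := hN.reachable_delete y (B.edge_vert hxy) hz hxy.adj_sub.ne hzy
    cases p with
    | nil => exact absurd rfl hzx
    | @cons _ w _ h p =>
      rw [deleteIncidenceSet_adj] at h
      refine hN.exists_iso_cycleGraph ?_ hxy h.1 h.2.2.symm
      intro a b₁ b₂ b₃ h₁ h₂ h₃ h₁₂
      by_contra! hcon
      exact hN.false_of_three_adj hc hc2 h₁ h₂ h₃ h₁₂ hcon.1 hcon.2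

end IsBlock

/-- The colors that `c` gives to `B` allow a rainbow cut between any two vertices of `B` as soon as
`B` is a cycle. -/
def IsGoodOn {V : Type*} {G : SimpleGraph V} (c : V → ℕ) (B : G.Subgraph) : Prop :=
  ∀ x ∈ B.verts, ∀ y ∈ B.verts, x ≠ y →
    (¬ B.Adj x y → ∃ s ∈ B.verts \ {x, y}, ∃ t ∈ B.verts \ {x, y}, c s ≠ c t) ∧
    (B.Adj x y → ∃ s ∈ B.verts \ {x, y}, c s ≠ c x ∨ c s ≠ c y)

/-- A cyclic enumeration of the vertices of `B`. -/
structure IsCyclicLabelling {V : Type*} {G : SimpleGraph V} (B : G.Subgraph) {m : ℕ}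
    (f : Fin m → V) : Prop where
  injective : Function.Injective f
  range_eq : Set.range f = B.verts
  adj_iff : ∀ i j : Fin m, B.Adj (f i) (f j) ↔ i.val + 1 = j.val ∨ j.val + 1 = i.val ∨
    (i.val = 0 ∧ j.val + 1 = m) ∨ (j.val = 0 ∧ i.val + 1 = m)

section

variable {V : Type*} {G : SimpleGraph V} {B : G.Subgraph}

theorem exists_isCyclicLabelling {m : ℕ} (hm : 3 ≤ m) (e : B.coe ≃g cycleGraph m) {x : V}
    (hx : x ∈ B.verts) :
    ∃ f : Fin m → V, IsCyclicLabelling B f ∧ f ⟨0, by omega⟩ = x := by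
  have : NeZero m := ⟨by omega⟩
  refine ⟨fun i => e.symm (i + e ⟨x, hx⟩), ⟨?_, ?_, ?_⟩, ?_⟩
  · intro i j h
    exact add_right_cancel (e.symm.injective (Subtype.ext h))
  · ext v
    constructor
    · rintro ⟨i, rfl⟩
      exact (e.symm _).2
    · intro hv
      exact ⟨e ⟨v, hv⟩ - e ⟨x, hx⟩, by simp⟩
  · intro i j
    rw [← cycleGraph_adj_val (by omega)]
    have h : (cycleGraph m).Adj (i + e ⟨x, hx⟩) (j + e ⟨x, hx⟩) ↔ (cycleGraph m).Adj i j := by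
      simp only [cycleGraph_adj', add_sub_add_right_eq_sub]
    rw [← h]
    exact e.symm.map_adj_iff
  · have h0 : (⟨0, by omega⟩ : Fin m) = 0 := rfl
    simp [h0]

namespace IsCyclicLabelling

variable {m : ℕ} {f : Fin m → V}

theorem mem (hf : IsCyclicLabelling B f) (i : Fin m) : f i ∈ B.verts :=
  hf.range_eq ▸ Set.mem_range_self i

theorem exists_eq (hf : IsCyclicLabelling B f) {x : V} (hx : x ∈ B.verts) : ∃ i, f i = x := by
  rwa [← hf.range_eq] at hx

theorem isGoodOn (hf : IsCyclicLabelling B f) (hm : 3 ≤ m) {c : V → ℕ}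
    (hc : ∀ i, c (f i) = if i.val < 2 then 0 else 1) : IsGoodOn c B := by
  intro x hx y hy hxy
  obtain ⟨i, rfl⟩ := hf.exists_eq hx
  obtain ⟨j, rfl⟩ := hf.exists_eq hy
  have hij : i.val ≠ j.val := fun h => hxy (congrArg f (Fin.ext h))
  have hmem : ∀ k : Fin m, k.val ≠ i.val → k.val ≠ j.val → f k ∈ B.verts \ {f i, f j} := by
    intro k hki hkj
    refine ⟨hf.mem k, ?_⟩
    rintro (h | h)
    exacts [hki (congrArg Fin.val (hf.injective h)), hkj (congrArg Fin.val (hf.injective h))]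
  have hi := i.2
  have hj := j.2
  rw [hf.adj_iff]
  constructor
  · intro hadj
    obtain ⟨s, hs, hsi, hsj⟩ : ∃ s, s < 2 ∧ s ≠ i.val ∧ s ≠ j.val := by
      by_cases h : 0 ≠ i.val ∧ 0 ≠ j.val
      exacts [⟨0, by omega⟩, ⟨1, by omega⟩]
    obtain ⟨t, ht, htm, hti, htj⟩ : ∃ t, 2 ≤ t ∧ t < m ∧ t ≠ i.val ∧ t ≠ j.val := by
      by_cases h : 2 ≠ i.val ∧ 2 ≠ j.val
      · exact ⟨2, by omega⟩
      · by_cases h' : 3 ≠ i.val ∧ 3 ≠ j.val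
        exacts [⟨3, by omega⟩, ⟨4, by omega⟩]
    refine ⟨_, hmem ⟨s, by omega⟩ hsi hsj, _, hmem ⟨t, htm⟩ hti htj, ?_⟩
    rw [hc, hc, if_pos hs, if_neg (by dsimp only; omega)]
    omega
  · intro _
    obtain ⟨s, hs, hsi, hsj, h⟩ : ∃ s, s < m ∧ s ≠ i.val ∧ s ≠ j.val ∧
        ((s < 2 ∧ 2 ≤ i.val) ∨ (s < 2 ∧ 2 ≤ j.val) ∨ (2 ≤ s ∧ i.val < 2) ∨
          (2 ≤ s ∧ j.val < 2)) := by
      by_cases h : 0 ≠ i.val ∧ 0 ≠ j.val ∧ (2 ≤ i.val ∨ 2 ≤ j.val)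
      · exact ⟨0, by omega⟩
      · by_cases h' : 1 ≠ i.val ∧ 1 ≠ j.val ∧ (2 ≤ i.val ∨ 2 ≤ j.val)
        exacts [⟨1, by omega⟩, ⟨2, by omega⟩]
    refine ⟨_, hmem ⟨s, hs⟩ hsi hsj, ?_⟩
    simp only [hc]
    split_ifs <;> omega

end IsCyclicLabelling

theorem IsBlock.adj_iff (hB : IsBlock G B) {x y : V} (hx : x ∈ B.verts) (hy : y ∈ B.verts) :
    B.Adj x y ↔ G.Adj x y :=
  ⟨fun h => h.adj_sub, hB.adj_of_adj hx hy⟩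

theorem IsBlock.exists_cut_of_iso_cycleGraph (hB : IsBlock G B) (hG : G.Connected) {m : ℕ}
    (hm : 3 ≤ m) (e : B.coe ≃g cycleGraph m) {c : V → ℕ} (hc : IsGoodOn c B) {x y : V}
    (hx : x ∈ B.verts) (hy : y ∈ B.verts) (hxy : x ≠ y) :
    ∃ S : Set V, x ∉ S ∧ y ∉ S ∧
      (∀ p : (G.deleteEdges {s(x, y)}).Walk x y, ∃ v ∈ p.support, v ∈ S) ∧
      (¬ G.Adj x y → RainbowSet c S) ∧
      (G.Adj x y → (RainbowSet c (insert x S) ∨ RainbowSet c (insert y S))) := by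
  obtain ⟨f, hf, rfl⟩ := exists_isCyclicLabelling hm e hx
  obtain ⟨j, rfl⟩ := hf.exists_eq hy
  have hj := j.2
  have hj0 : 0 < j.val := by
    rcases Nat.eq_zero_or_pos j.val with h | h
    · exact absurd (congrArg f (Fin.ext h.symm)) hxy
    · exact h
  have hval : ∀ k l, f k = f l → k.val = l.val := fun k l h => congrArg Fin.val (hf.injective h)
  -- it suffices to find a set of labels that is closed under the allowed steps
  have cut : ∀ (S : Set V) (A : ℕ → Prop), A 0 → ¬ A j.val →
      (∀ k l : Fin m, B.Adj (f k) (f l) → ¬ (k.val = 0 ∧ l.val = j.val) → f k ∉ S → f l ∉ S →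
        A k → A l) →
      ∀ p : (G.deleteEdges {s(f ⟨0, by omega⟩, f j)}).Walk (f ⟨0, by omega⟩) (f j),
        ∃ v ∈ p.support, v ∈ S := by
    intro S A h0 hAj hA p
    refine hB.exists_mem_support hG hx hy S {v | ∃ k : Fin m, A k ∧ f k = v} ⟨_, h0, rfl⟩ ?_ ?_ p
    · rintro ⟨k, hk, hkj⟩
      rw [hval _ _ hkj] at hk
      exact hAj hk
    · rintro a b hab hne ha hb ⟨k, hk, rfl⟩
      obtain ⟨l, rfl⟩ := hf.exists_eq (B.edge_vert hab.symm)
      refine ⟨l, hA k l hab ?_ ha hb hk, rfl⟩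
      rintro ⟨hk0, hlj⟩
      apply hne
      rw [show k = ⟨0, by omega⟩ from Fin.ext hk0, show l = j from Fin.ext hlj]
  by_cases hadj : B.Adj (f ⟨0, by omega⟩) (f j)
  · obtain ⟨s, ⟨hs, hsxy⟩, hcs⟩ := (hc _ hx _ hy hxy).2 hadj
    obtain ⟨s, rfl⟩ := hf.exists_eq hs
    simp only [Set.mem_insert_iff, Set.mem_singleton_iff, not_or] at hsxy
    have hs0 : s.val ≠ 0 := fun h => hsxy.1 (congrArg f (Fin.ext h))
    have hsj : s.val ≠ j.val := fun h => hsxy.2 (congrArg f (Fin.ext h))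
    refine ⟨{f s}, fun h => hsxy.1 h.symm, fun h => hsxy.2 h.symm, ?_,
      fun h => absurd hadj.adj_sub h, fun _ => ?_⟩
    · have hadj' := (hf.adj_iff _ _).1 hadj
      dsimp only at hadj'
      have hs' := s.2
      refine cut {f s} (fun k => if j.val = 1 then k = 0 ∨ s.val < k else k < s.val) ?_ ?_ ?_
      · split_ifs <;> omega
      · split_ifs <;> omega
      · intro k l hkl h hk hl
        have hk' : k.val ≠ s.val := fun h => hk (congrArg f (Fin.ext h))
        have hl' : l.val ≠ s.val := fun h => hl (congrArg f (Fin.ext h))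
        rw [hf.adj_iff] at hkl
        have hk'' := k.2
        have hl'' := l.2
        split_ifs <;> omega
    · rcases hcs with h | h
      · left
        rw [RainbowSet, Set.injOn_pair]
        exact fun h' => absurd h'.symm h
      · right
        rw [RainbowSet, Set.injOn_pair]
        exact fun h' => absurd h'.symm h
  · obtain ⟨s, ⟨hs, hsxy⟩, t, ⟨ht, htxy⟩, hst⟩ := (hc _ hx _ hy hxy).1 hadj
    obtain ⟨s, rfl⟩ := hf.exists_eq hs
    obtain ⟨t, rfl⟩ := hf.exists_eq ht
    simp only [Set.mem_insert_iff, Set.mem_singleton_iff, not_or] at hsxy htxy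
    have hs0 : s.val ≠ 0 := fun h => hsxy.1 (congrArg f (Fin.ext h))
    have hsj : s.val ≠ j.val := fun h => hsxy.2 (congrArg f (Fin.ext h))
    have ht0 : t.val ≠ 0 := fun h => htxy.1 (congrArg f (Fin.ext h))
    have htj : t.val ≠ j.val := fun h => htxy.2 (congrArg f (Fin.ext h))
    have hadj' := mt (hf.adj_iff _ _).2 hadj
    dsimp only at hadj'
    obtain ⟨a, b, ha0, haj, hbj, hab⟩ : ∃ a b : Fin m, 0 < a.val ∧ a.val < j.val ∧
        j.val < b.val ∧ c (f a) ≠ c (f b) := by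
      have hs' := s.2
      have ht' := t.2
      rcases lt_or_gt_of_ne hsj with h | h <;> rcases lt_or_gt_of_ne htj with h' | h'
      · have hb : j.val < (⟨j.val + 1, by omega⟩ : Fin m).val := Nat.lt_succ_self _
        by_cases hcs : c (f s) = c (f ⟨j.val + 1, by omega⟩)
        · exact ⟨t, _, by omega, h', hb, fun h => hst (hcs.trans h.symm)⟩
        · exact ⟨s, _, by omega, h, hb, hcs⟩
      · exact ⟨s, t, by omega, h, h', hst⟩
      · exact ⟨t, s, by omega, h', h, hst.symm⟩
      · have h1 : (⟨1, by omega⟩ : Fin m).val < j.val := by dsimp only; omega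
        by_cases hcs : c (f ⟨1, by omega⟩) = c (f s)
        · exact ⟨_, t, one_pos, h1, h', fun h => hst (hcs.symm.trans h)⟩
        · exact ⟨_, s, one_pos, h1, h, hcs⟩
    refine ⟨{f a, f b}, ?_, ?_, ?_, fun _ => ?_, fun h => absurd (hB.adj_of_adj hx hy h) hadj⟩
    · rintro (h | h) <;> have := hval _ _ h <;> dsimp only at this <;> omega
    · rintro (h | h) <;> have := hval _ _ h <;> omega
    · refine cut {f a, f b} (fun k => k < a.val ∨ b.val < k) (by omega) (by omega) ?_
      intro k l hkl h hk hl
      simp only [Set.mem_insert_iff, Set.mem_singleton_iff, not_or] at hk hl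
      have hka : k.val ≠ a.val := fun h => hk.1 (congrArg f (Fin.ext h))
      have hla : l.val ≠ a.val := fun h => hl.1 (congrArg f (Fin.ext h))
      have hkb : k.val ≠ b.val := fun h => hk.2 (congrArg f (Fin.ext h))
      have hlb : l.val ≠ b.val := fun h => hl.2 (congrArg f (Fin.ext h))
      rw [hf.adj_iff] at hkl
      have := b.2
      have := k.2
      have := l.2
      omega
    · rw [RainbowSet, Set.injOn_pair]
      exact fun h' => absurd h' hab

theorem IsBlock.exists_cut_of_iso_top (hB : IsBlock G B) (hG : G.Connected)
    (e : B.coe ≃g (⊤ : SimpleGraph (Fin 2))) (c : V → ℕ) {x y : V}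
    (hx : x ∈ B.verts) (hy : y ∈ B.verts) (hxy : x ≠ y) :
    ∃ S : Set V, x ∉ S ∧ y ∉ S ∧
      (∀ p : (G.deleteEdges {s(x, y)}).Walk x y, ∃ v ∈ p.support, v ∈ S) ∧
      (¬ G.Adj x y → RainbowSet c S) ∧
      (G.Adj x y → (RainbowSet c (insert x S) ∨ RainbowSet c (insert y S))) := by
  have hexy : e ⟨x, hx⟩ ≠ e ⟨y, hy⟩ := fun h => hxy (congrArg Subtype.val (e.injective h))
  have hverts : ∀ v ∈ B.verts, v = x ∨ v = y := by
    intro v hv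
    have h : e ⟨v, hv⟩ = e ⟨x, hx⟩ ∨ e ⟨v, hv⟩ = e ⟨y, hy⟩ := by omega
    rcases h with h | h
    exacts [Or.inl (congrArg Subtype.val (e.injective h)),
      Or.inr (congrArg Subtype.val (e.injective h))]
  refine ⟨∅, by simp, by simp, ?_, by simp [RainbowSet], by simp [RainbowSet]⟩
  refine hB.exists_mem_support hG hx hy ∅ {x} rfl hxy.symm ?_
  rintro a b hab hne - - rfl
  rcases hverts b (B.edge_vert hab.symm) with rfl | rfl
  · rfl
  · exact absurd rfl hne

/-- Two vertices without a common block are separated by a single vertex. -/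
theorem exists_separating_vertex [Finite V] {x y z : V} (h : G.Adj x z) (q : G.Walk z y)
    (hp : (Walk.cons h q).IsPath) (hB : IsBlock G B) (hx : x ∈ B.verts) (hz : z ∈ B.verts) :
    y ∈ B.verts ∨ ∃ v, v ≠ x ∧ v ≠ y ∧ ¬ (G.deleteIncidenceSet v).Reachable x y := by
  induction q generalizing x B with
  | nil => exact Or.inl hz
  | @cons z w y h' q ih =>
    rw [Walk.cons_isPath_iff] at hp
    obtain ⟨hq, hxq⟩ := hp
    obtain ⟨B', hB', hle⟩ := Subgraph.IsNonseparable.exists_isBlock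
      (Subgraph.IsNonseparable.subgraphOfAdj h') ⟨z, by simp⟩
    have hzB' : z ∈ B'.verts := hle.1 (by simp)
    have hwB' : w ∈ B'.verts := hle.1 (by simp)
    have hq' := (Walk.cons_isPath_iff _ _).1 hq
    by_cases hBB : B = B'
    · subst hBB
      rcases ih h' hq hB' hzB' hwB' with hy | ⟨v, hvz, hvy, hv⟩
      · exact Or.inl hy
      · right
        have hvx : v ≠ x := by
          rintro rfl
          exact hv ((Walk.cons h' q).reachable_deleteIncidenceSet (fun a b h => h.adj_sub) hxq)
        refine ⟨v, hvx, hvy, fun hr => hv ((Adj.reachable ?_).trans hr)⟩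
        rw [deleteIncidenceSet_adj]
        exact ⟨h.symm, hvz.symm, hvx.symm⟩
    · right
      refine ⟨z, h.ne', ?_, fun hr => hBB ?_⟩
      · rintro rfl
        exact hq'.2 q.end_mem_support
      · have hwy := q.reachable_deleteIncidenceSet (H := G) (fun a b h => h.adj_sub) hq'.2
        obtain ⟨C, hC, hzx, hzw⟩ :=
          Subgraph.IsNonseparable.exists_of_reachable h.symm h' (hr.trans hwy.symm)
        obtain ⟨D, hD, hCD⟩ := hC.exists_isBlock ⟨z, C.edge_vert hzx⟩
        have hzD := hCD.1 (C.edge_vert hzx)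
        exact (hB.eq_of_two_verts hD h.ne hx (hCD.1 (C.edge_vert hzx.symm)) hz hzD).trans
          (hB'.eq_of_two_verts hD h'.ne hzB' hzD hwB' (hCD.1 (C.edge_vert hzw.symm))).symm

theorem isRVDColoring_of_isGoodOn [Finite V] (hG : G.Connected) {c : V → ℕ}
    (hc : ∀ B : G.Subgraph, IsBlock G B → Nonempty (B.coe ≃g (⊤ : SimpleGraph (Fin 2))) ∨
      IsGoodOn c B ∧ ∃ m : ℕ, 3 ≤ m ∧ Nonempty (B.coe ≃g SimpleGraph.cycleGraph m)) :
    IsRVDColoring G c := by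
  intro x y hxy
  by_cases hcom : ∃ B : G.Subgraph, IsBlock G B ∧ x ∈ B.verts ∧ y ∈ B.verts
  · obtain ⟨B, hB, hx, hy⟩ := hcom
    rcases hc B hB with ⟨⟨e⟩⟩ | ⟨hgood, m, hm, ⟨e⟩⟩
    · exact hB.exists_cut_of_iso_top hG e c hx hy hxy
    · exact hB.exists_cut_of_iso_cycleGraph hG hm e hgood hx hy hxy
  · obtain ⟨p, hp⟩ := (hG.preconnected x y).exists_isPath
    have hedge : ∀ z, G.Adj x z → ∃ B : G.Subgraph, IsBlock G B ∧ x ∈ B.verts ∧ z ∈ B.verts := by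
      intro z h
      obtain ⟨B, hB, hle⟩ := Subgraph.IsNonseparable.exists_isBlock
        (Subgraph.IsNonseparable.subgraphOfAdj h) ⟨x, by simp⟩
      exact ⟨B, hB, hle.1 (by simp), hle.1 (by simp)⟩
    cases p with
    | nil => exact absurd rfl hxy
    | @cons _ z _ h q =>
      obtain ⟨B, hB, hx, hz⟩ := hedge z h
      rcases exists_separating_vertex h q hp hB hx hz with hy | ⟨v, hvx, hvy, hv⟩
      · exact absurd ⟨B, hB, hx, hy⟩ hcom
      · refine ⟨{v}, hvx.symm, hvy.symm, fun r => ⟨v, ?_, rfl⟩, by simp [RainbowSet],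
          fun hadj => absurd (hedge y hadj) hcom⟩
        by_contra hvr
        exact hv (r.reachable_deleteIncidenceSet
          (fun a b h => deleteEdges_le _ (h.adj_sub)) hvr)

theorem exists_isGoodOn [Finite V] (hG : G.Connected) :
    ∃ c : V → ℕ, (∀ v, c v < 2) ∧ ∀ B : G.Subgraph, IsBlock G B →
      (∃ m : ℕ, 3 ≤ m ∧ Nonempty (B.coe ≃g SimpleGraph.cycleGraph m)) → IsGoodOn c B := by
  suffices h : ∀ F : Set G.Subgraph, F.Finite →
      (∀ B ∈ F, IsBlock G B ∧ ∃ m : ℕ, 3 ≤ m ∧ Nonempty (B.coe ≃g SimpleGraph.cycleGraph m)) →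
      ∃ c : V → ℕ, (∀ v, c v < 2) ∧ ∀ B ∈ F, IsGoodOn c B by
    obtain ⟨c, hc, hg⟩ := h {B | IsBlock G B ∧ ∃ m : ℕ, 3 ≤ m ∧
      Nonempty (B.coe ≃g SimpleGraph.cycleGraph m)} (Set.toFinite _) (fun B hB => hB)
    exact ⟨c, hc, fun B hB hm => hg B ⟨hB, hm⟩⟩
  intro F hF
  induction F, hF using Set.Finite.induction_on with
  | empty => exact fun _ => ⟨fun _ => 0, by simp, by simp⟩
  | @insert B F hBF _ ih =>
    intro hall
    obtain ⟨c, hc, hg⟩ := ih (fun B' hB' => hall B' (Set.mem_insert_of_mem _ hB'))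
    obtain ⟨hB, m, hm, ⟨e⟩⟩ := hall B (Set.mem_insert _ _)
    obtain ⟨x, hx⟩ := hB.nonempty
    obtain ⟨f, hf, -⟩ := exists_isCyclicLabelling hm e hx
    obtain ⟨π, hπ, hπB, hπD⟩ := hB.exists_proj hG
    choose g hgf using fun v => hf.exists_eq (hπ v)
    -- recolor each part hanging off `B` uniformly so that `B` itself gets a good pattern
    refine ⟨fun v => (c v + c (π v) + if (g v).val < 2 then 0 else 1) % 2,
      fun v => Nat.mod_lt _ two_pos, ?_⟩
    rintro B' (rfl | hB'F)
    · refine hf.isGoodOn hm fun i => ?_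
      have hi : π (f i) = f i := hπB _ (hf.mem i)
      have hgi : g (f i) = i := hf.injective ((hgf _).trans hi)
      rw [hi, hgi]
      split_ifs <;> omega
    · have hB' := (hall B' (Set.mem_insert_of_mem _ hB'F)).1
      have hne : B' ≠ B := fun h => hBF (h ▸ hB'F)
      have hconst : ∀ u ∈ B'.verts, ∀ v ∈ B'.verts, π u = π v := by
        intro u hu v hv
        obtain ⟨p⟩ := hB'.isNonseparable.reachable hu hv
        clear hu hv
        induction p with
        | nil => rfl
        | @cons a b _ h p ih =>
          have h' : B'.Adj a b := h
          refine (hπD a b ⟨h'.adj_sub, fun hab => hne ?_⟩).trans ih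
          have hab' : B.Adj a b := hab
          exact hB'.eq_of_two_verts hB h'.adj_sub.ne (B'.edge_vert h') (B.edge_vert hab')
            (B'.edge_vert h'.symm) (B.edge_vert hab'.symm)
      have hiff : ∀ u ∈ B'.verts, ∀ v ∈ B'.verts, c u ≠ c v →
          (c u + c (π u) + if (g u).val < 2 then 0 else 1) % 2 ≠
            (c v + c (π v) + if (g v).val < 2 then 0 else 1) % 2 := by
        intro u hu v hv huv
        have hgg : g u = g v := hf.injective (by rw [hgf, hgf, hconst u hu v hv])
        have := hc u
        have := hc v
        rw [hgg, hconst u hu v hv]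
        omega
      intro a ha b hb hab
      obtain ⟨h₁, h₂⟩ := hg B' hB'F a ha b hb hab
      constructor
      · intro h
        obtain ⟨s, hs, t, ht, hst⟩ := h₁ h
        exact ⟨s, hs, t, ht, hiff s hs.1 t ht.1 hst⟩
      · intro h
        obtain ⟨s, hs, hst⟩ := h₂ h
        exact ⟨s, hs, hst.imp (hiff s hs.1 a ha) (hiff s hs.1 b hb)⟩

theorem two_le_ncard_range_of_iso_cycleGraph [Finite V] (hB : IsBlock G B) {m : ℕ} (hm : 3 ≤ m)
    (e : B.coe ≃g cycleGraph m) {c : V → ℕ} (hc : IsRVDColoring G c) :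
    2 ≤ (Set.range c).ncard := by
  by_contra! hlt
  have hconst : ∀ u v, c u = c v := fun u v =>
    (Set.ncard_le_one (Set.finite_range c)).1 (by omega) _ ⟨u, rfl⟩ _ ⟨v, rfl⟩
  obtain ⟨x, hx⟩ := hB.nonempty
  obtain ⟨f, hf, -⟩ := exists_isCyclicLabelling hm e hx
  have h₁ : B.Adj (f ⟨0, by omega⟩) (f ⟨1, by omega⟩) := (hf.adj_iff _ _).2 (Or.inl rfl)
  have h₂ : B.Adj (f ⟨0, by omega⟩) (f ⟨m - 1, by omega⟩) :=
    (hf.adj_iff _ _).2 (Or.inr (Or.inr (Or.inl ⟨rfl, by dsimp only; omega⟩)))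
  have h₁₂ : f ⟨m - 1, by omega⟩ ≠ f ⟨1, by omega⟩ := by
    intro h
    have := congrArg Fin.val (hf.injective h)
    dsimp only at this
    omega
  generalize f ⟨0, by omega⟩ = a at *
  generalize f ⟨1, by omega⟩ = b at *
  generalize f ⟨m - 1, by omega⟩ = d at *
  obtain ⟨S, haS, hbS, hS, -, had⟩ := hc a b h₁.adj_sub.ne
  have hempty : ∀ s, s ∉ S := by
    intro s hs
    rcases had h₁.adj_sub with h | h
    · exact haS (h (Set.mem_insert_of_mem _ hs) (Set.mem_insert _ _) (hconst _ _) ▸ hs)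
    · exact hbS (h (Set.mem_insert_of_mem _ hs) (Set.mem_insert _ _) (hconst _ _) ▸ hs)
  obtain ⟨p⟩ := hB.isNonseparable.reachable_delete a (B.edge_vert h₂.symm) (B.edge_vert h₁.symm)
    h₂.adj_sub.ne' h₁.adj_sub.ne'
  have hle : B.spanningCoe.deleteIncidenceSet a ≤ G.deleteEdges {s(a, b)} := by
    intro u v h
    rw [deleteIncidenceSet_adj] at h
    rw [deleteEdges_adj, Set.mem_singleton_iff, Sym2.eq_iff]
    refine ⟨h.1.adj_sub, ?_⟩
    rintro (⟨h', -⟩ | ⟨-, h'⟩)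
    exacts [h.2.1 h', h.2.2 h']
  have hadj : (G.deleteEdges {s(a, b)}).Adj a d := by
    rw [deleteEdges_adj, Set.mem_singleton_iff, Sym2.eq_iff]
    refine ⟨h₂.adj_sub, ?_⟩
    rintro (⟨-, h'⟩ | ⟨h', -⟩)
    exacts [h₁₂ h', h₁.adj_sub.ne h']
  obtain ⟨s, -, hs⟩ := hS (Walk.cons hadj (p.mapLe hle))
  exact hempty s hs

end

/-- For a nontrivial connected graph `G`, `rvd G = 2` if and only if each block of
`G` is either a `K 2` or a cycle, and at least one block of `G` is a cycle. -/
theorem stmt7 {V : Type*} [Fintype V] (G : SimpleGraph V) (hG : G.Connected)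
    (hn : 2 ≤ Fintype.card V) :
    rvd G = 2 ↔
      ((∀ B : G.Subgraph, IsBlock G B →
          (Nonempty (B.coe ≃g (⊤ : SimpleGraph (Fin 2))) ∨
            ∃ m : ℕ, 3 ≤ m ∧ Nonempty (B.coe ≃g SimpleGraph.cycleGraph m))) ∧
        (∃ B : G.Subgraph, IsBlock G B ∧
          ∃ m : ℕ, 3 ≤ m ∧ Nonempty (B.coe ≃g SimpleGraph.cycleGraph m))) := by
  have : Nontrivial V := Fintype.one_lt_card_iff_nontrivial.1 (by omega)
  constructor
  · intro h
    have hne : {k | ∃ c : V → ℕ, IsRVDColoring G c ∧ (Set.range c).ncard = k}.Nonempty := by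
      by_contra hemp
      rw [Set.not_nonempty_iff_eq_empty] at hemp
      rw [rvd, hemp, Nat.sInf_empty] at h
      omega
    obtain ⟨c, hc, hc2⟩ := Nat.sInf_mem hne
    have hblocks := fun (B : G.Subgraph) (hB : IsBlock G B) =>
      hB.iso_top_or_iso_cycleGraph hG hc (hc2.trans h).le
    refine ⟨hblocks, ?_⟩
    by_contra! hno
    have hconst : IsRVDColoring G (fun _ => 0) := isRVDColoring_of_isGoodOn hG fun B hB =>
      Or.inl ((hblocks B hB).resolve_right fun ⟨m, hm, ⟨e⟩⟩ => (hno B hB m hm).false e)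
    have hle : rvd G ≤ 1 := Nat.sInf_le ⟨_, hconst, by simp⟩
    omega
  · rintro ⟨hblocks, B, hB, m, hm, ⟨e⟩⟩
    obtain ⟨c, hc2, hgood⟩ := exists_isGoodOn hG
    have hc : IsRVDColoring G c := isRVDColoring_of_isGoodOn hG fun B hB =>
      (hblocks B hB).imp_right fun h => ⟨hgood B hB h, h⟩
    have hle : rvd G ≤ (Set.range c).ncard := Nat.sInf_le ⟨c, hc, rfl⟩
    have hrange : (Set.range c).ncard ≤ 2 := by
      refine (Set.ncard_le_ncard (t := Set.Iio 2) ?_ (Set.finite_Iio 2)).trans (by simp)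
      rintro _ ⟨v, rfl⟩
      exact hc2 v
    obtain ⟨d, hd, hd2⟩ := Nat.sInf_mem
      (s := {k | ∃ c : V → ℕ, IsRVDColoring G c ∧ (Set.range c).ncard = k}) ⟨_, c, hc, rfl⟩
    have hge := two_le_ncard_range_of_iso_cycleGraph hB hm e hd
    rw [hd2] at hge
    exact (hle.trans hrange).antisymm hge
end

section
/- Let G be a nontrivial connected graph of order n. Then rvd(G) = n if and only if any two distinct vertices of G have at least two common neighbors. -/
open SimpleGraph

/-- If `x`, `y` are nonadjacent and `w` is not a common neighbor of them, then the complement of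
`{x, y, w}` meets every `x`-`y` walk. -/
theorem SimpleGraph.Walk.exists_mem_support_of_not_adj {V : Type*} {H : SimpleGraph V} {x y w : V}
    (hxy : x ≠ y) (hadj : ¬ H.Adj x y) (hw : ¬ (H.Adj x w ∧ H.Adj w y)) (p : H.Walk x y) :
    ∃ v ∈ p.support, v ∈ ({x, y, w}ᶜ : Set V) := by
  by_contra! hcon
  have hmem (d : H.Dart) (hd : d ∈ p.darts) : d.snd = x ∨ d.snd = y ∨ d.snd = w := by
    simpa [or_iff_not_imp_left] using hcon _ (p.dart_snd_mem_support_of_mem_darts hd)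
  by_cases hyw : y = w ∨ ¬ H.Adj x w
  · obtain ⟨d, hd, h₁, h₂⟩ := p.exists_boundary_dart {x} rfl (by simpa using hxy.symm)
    have had := d.adj
    grind
  · obtain ⟨d, hd, h₁, h₂⟩ := p.exists_boundary_dart {x, w} (by simp) (by grind)
    have had := d.adj
    grind

/-- Two distinct vertices of the same color have at most one common neighbor. -/
theorem IsRVDColoring.ne_of_twoCommonNbrs {V : Type*} {G : SimpleGraph V} {c : V → ℕ}
    (hc : IsRVDColoring G c) {u v : V} (huv : u ≠ v) (h : TwoCommonNbrs G u v) : c u ≠ c v := by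
  obtain ⟨a, b, hab, hua, hva, hub, hvb⟩ := h
  obtain ⟨S, haS, hbS, hcut, hnadj, hadj⟩ := hc a b hab
  have hmem {z : V} (hza : G.Adj z a) (hzb : G.Adj z b) : z ∈ S := by
    have h₁ : (G.deleteEdges {s(a, b)}).Adj a z := by
      have := hzb.ne
      have := hza.ne
      simp [SimpleGraph.deleteEdges_adj, hza.symm]
      grind
    have h₂ : (G.deleteEdges {s(a, b)}).Adj z b := by
      have := hza.ne
      have := hzb.ne
      simp [SimpleGraph.deleteEdges_adj, hzb]
      grind
    obtain ⟨t, ht, htS⟩ := hcut (.cons h₁ (.cons h₂ .nil))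
    simp only [Walk.support_cons, Walk.support_nil, List.mem_cons, List.not_mem_nil,
      or_false] at ht
    grind
  have hS : RainbowSet c S := by
    by_cases h : G.Adj a b
    · exact (hadj h).elim (fun h => h.mono (Set.subset_insert _ _))
        (fun h => h.mono (Set.subset_insert _ _))
    · exact hnadj h
  exact fun heq => huv (hS (hmem hua hub) (hmem hva hvb) heq)

/-- A coloring whose only possible coincidence is `c u = c v` is a rainbow vertex-disconnection
coloring, provided `u` and `v` have at most one common neighbor. -/
theorem isRVDColoring_of_not_twoCommonNbrs {V : Type*} {G : SimpleGraph V} {c : V → ℕ} {u v : V}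
    (h : ¬ TwoCommonNbrs G u v)
    (hc : ∀ s t, c s = c t → s = t ∨ (s = u ∧ t = v) ∨ (s = v ∧ t = u)) :
    IsRVDColoring G c := by
  have hrain {S : Set V} (hS : u ∉ S ∨ v ∉ S) : RainbowSet c S := by
    intro s hs t ht hst
    have := hc s t hst
    grind
  intro x y hxy
  have key : ∃ w, ¬ (G.Adj x w ∧ G.Adj w y) ∧
      ((u ∉ insert x ({x, y, w}ᶜ : Set V) ∨ v ∉ insert x ({x, y, w}ᶜ : Set V)) ∨
        (u ∉ insert y ({x, y, w}ᶜ : Set V) ∨ v ∉ insert y ({x, y, w}ᶜ : Set V))) := by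
    simp only [Set.mem_insert_iff, Set.mem_compl_iff, Set.mem_singleton_iff]
    by_cases hx : x = u ∨ x = v
    · exact ⟨x, by simp, by grind⟩
    by_cases hy : y = u ∨ y = v
    · exact ⟨y, by simp, by grind⟩
    by_cases hu : G.Adj x u ∧ G.Adj u y
    · refine ⟨v, fun hv => h ⟨x, y, hxy, hu.1.symm, hv.1.symm, hu.2, hv.2⟩, by grind⟩
    · exact ⟨u, hu, by grind⟩
  obtain ⟨w, hw, hS⟩ := key
  have hS' := hS.imp hrain hrain
  refine ⟨{x, y, w}ᶜ, by simp, by simp, fun p => ?_, fun _ => ?_, fun _ => hS'⟩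
  · refine p.exists_mem_support_of_not_adj hxy (by simp) fun hw' => hw ?_
    exact ⟨(G.deleteEdges_le _) hw'.1, (G.deleteEdges_le _) hw'.2⟩
  · exact hS'.elim (fun h => h.mono (Set.subset_insert _ _))
      (fun h => h.mono (Set.subset_insert _ _))

/-- An injective coloring is a rainbow vertex-disconnection coloring. -/
theorem isRVDColoring_of_injective {V : Type*} {G : SimpleGraph V} {c : V → ℕ}
    (hc : Function.Injective c) : IsRVDColoring G c := by
  intro x y hxy
  exact ⟨{x, y, x}ᶜ, by simp, by simp,
    fun p => p.exists_mem_support_of_not_adj hxy (by simp) (by simp),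
    fun _ => hc.injOn, fun _ => .inl hc.injOn⟩

/-- For a nontrivial connected graph `G` of order `n`, `rvd G = n` if and only if
any two distinct vertices of `G` have at least two common neighbors. -/
theorem stmt8 {V : Type*} [Fintype V] (G : SimpleGraph V) (hG : G.Connected)
    (hn : 2 ≤ Fintype.card V) :
    rvd G = Fintype.card V ↔ ∀ u v : V, u ≠ v → TwoCommonNbrs G u v := by
  obtain ⟨e, he⟩ : ∃ e : V → ℕ, Function.Injective e := Countable.exists_injective_nat V
  constructor
  · intro hr u v huv
    by_contra hcon
    classical
    let c : V → ℕ := fun z => if z = v then e u else e z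
    have hc : IsRVDColoring G c := isRVDColoring_of_not_twoCommonNbrs hcon fun s t hst => by
      simp only [c] at hst
      split_ifs at hst <;> grind [Function.Injective]
    have hle : rvd G ≤ (Set.range c).ncard := Nat.sInf_le ⟨c, hc, rfl⟩
    have hsub : Set.range c ⊆ e '' {v}ᶜ := by
      rintro _ ⟨z, rfl⟩
      by_cases hz : z = v
      · exact ⟨u, huv, by simp [c, hz]⟩
      · exact ⟨z, hz, by simp [c, hz]⟩
    have hss : e '' {v}ᶜ ⊂ Set.range e := by
      rw [← Set.image_univ]
      exact he.image_strictMono (Set.ssubset_univ_iff.2 (by simp))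
    have hlt := Set.ncard_lt_ncard (hsub.trans_ssubset hss) (Set.finite_range e)
    rw [Set.ncard_range_of_injective he, Nat.card_eq_fintype_card] at hlt
    omega
  · intro h
    have hset : {k | ∃ c : V → ℕ, IsRVDColoring G c ∧ (Set.range c).ncard = k} =
        {Fintype.card V} := by
      ext k
      constructor
      · rintro ⟨c, hc, rfl⟩
        refine (Set.ncard_range_of_injective fun u v huv => ?_).trans Nat.card_eq_fintype_card
        by_contra hne
        exact hc.ne_of_twoCommonNbrs hne (h u v hne) huv
      · rintro rfl
        exact ⟨e, isRVDColoring_of_injective he,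
          (Set.ncard_range_of_injective he).trans Nat.card_eq_fintype_card⟩
    rw [rvd, hset, csInf_singleton]
end

section
/- Let G be a nontrivial connected graph of order n and girth g with g ≥ 4. Then rvd(G) ≤ n − g + 2. -/
open SimpleGraph

namespace SimpleGraph

variable {V : Type*} {G : SimpleGraph V}

/-- Closing up a path of length at least two by an edge gives a cycle. -/
lemma girth_le_length_add_one_of_isPath {u v : V} {p : G.Walk u v} (hp : p.IsPath)
    (hlen : 2 ≤ p.length) (h : G.Adj v u) : G.girth ≤ p.length + 1 := by
  have hc : (Walk.cons h p).IsCycle := by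
    rw [Walk.cons_isCycle_iff]
    refine ⟨hp, fun hm => ?_⟩
    have := hp.length_eq_one_of_mem_edges (Sym2.eq_swap ▸ hm)
    omega
  simpa using girth_le_length hc

/-- A walk leaving `T` meets `S` if every edge crossing the boundary of `T` has an end in `S`. -/
lemma Walk.exists_mem_support_of_boundary {u v : V} (p : G.Walk u v) {S T : Set V}
    (hu : u ∈ T) (hv : v ∉ T)
    (h : ∀ a ∈ T, ∀ b ∉ T, G.Adj a b → a ∈ S ∨ b ∈ S) : ∃ w ∈ p.support, w ∈ S := by
  obtain ⟨d, hd, h1, h2⟩ := p.exists_boundary_dart T hu hv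
  rcases h _ h1 _ h2 d.adj with h | h
  · exact ⟨_, p.dart_fst_mem_support_of_mem_darts hd, h⟩
  · exact ⟨_, p.dart_snd_mem_support_of_mem_darts hd, h⟩

/-- `v` lists, at the indices below `g`, the successive vertices of a cycle in `G`. -/
structure IsCycleEnum (G : SimpleGraph V) (g : ℕ) (v : ℕ → V) : Prop where
  injOn : ∀ i < g, ∀ j < g, v i = v j → i = j
  adj : ∀ i, i + 1 < g → G.Adj (v i) (v (i + 1))
  adj_last : G.Adj (v (g - 1)) (v 0)

namespace IsCycleEnum

variable {g : ℕ} {v : ℕ → V}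

lemma exists_isPath (hv : G.IsCycleEnum g v) (i d : ℕ) (hd : i + d < g) :
    ∃ p : G.Walk (v i) (v (i + d)), p.IsPath ∧ p.length = d ∧
      ∀ w ∈ p.support, ∃ k ≤ i + d, w = v k := by
  induction d with
  | zero => exact ⟨Walk.nil, by simp, rfl, by simpa using ⟨i, le_rfl, rfl⟩⟩
  | succ d ih =>
    obtain ⟨p, hp, hl, hs⟩ := ih (by omega)
    refine ⟨p.concat (hv.adj (i + d) hd), hp.concat (fun hm => ?_) _, by simp [hl], ?_⟩
    · obtain ⟨k, hk, he⟩ := hs _ hm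
      have := hv.injOn _ hd _ (by omega) he
      omega
    · intro w hw
      rw [Walk.support_concat, List.mem_append] at hw
      rcases hw with hw | hw
      · obtain ⟨k, hk, he⟩ := hs _ hw
        exact ⟨k, by omega, he⟩
      · exact ⟨_, le_rfl, List.mem_singleton.mp hw⟩

/-- A cycle of length the girth has no chord. -/
lemma eq_succ_or_of_adj (hv : G.IsCycleEnum g v) (hg : G.girth = g) {i j : ℕ} (hij : i < j)
    (hj : j < g) (h : G.Adj (v i) (v j)) : j = i + 1 ∨ (i = 0 ∧ j = g - 1) := by
  obtain ⟨d, rfl⟩ := Nat.exists_eq_add_of_lt hij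
  obtain ⟨p, hp, hl, -⟩ := hv.exists_isPath i (d + 1) hj
  by_contra hne
  have := girth_le_length_add_one_of_isPath hp (by omega) h.symm
  omega

/-- A vertex off a shortest cycle has two neighbours on it only if these are far apart in the
enumeration. -/
lemma le_of_adj_of_adj (hv : G.IsCycleEnum g v) (hg : G.girth = g) {x : V}
    (hx : ∀ k < g, x ≠ v k) {i j : ℕ} (hij : i < j) (hj : j < g)
    (hi' : G.Adj x (v i)) (hj' : G.Adj x (v j)) : g ≤ j - i + 2 := by
  obtain ⟨d, rfl⟩ := Nat.exists_eq_add_of_lt hij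
  obtain ⟨p, hp, hl, hs⟩ := hv.exists_isPath i (d + 1) hj
  have hp' : (Walk.cons hi' p).IsPath := hp.cons fun hm => by
    obtain ⟨k, hk, he⟩ := hs _ hm
    exact hx k (by omega) he
  have := girth_le_length_add_one_of_isPath hp' (by simp [hl]) hj'.symm
  simp only [Walk.length_cons] at this
  omega

end IsCycleEnum

/-- The enumeration of a shortest cycle. -/
lemma exists_isCycleEnum_girth (h : 0 < G.girth) : ∃ v, G.IsCycleEnum G.girth v := by
  have h3 := three_le_girth (mt girth_eq_zero.mpr h.ne')
  obtain ⟨a, w, hw, hl⟩ := exists_girth_eq_length.mpr (mt girth_eq_zero.mpr h.ne')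
  refine ⟨w.getVert, fun i hi j hj he => ?_, fun i hi => w.adj_getVert_succ (by omega), ?_⟩
  · exact hw.getVert_injOn' (by simp only [Set.mem_ofPred_eq]; omega)
      (by simp only [Set.mem_ofPred_eq]; omega) he
  · rw [w.getVert_zero]
    have := w.adj_getVert_succ (i := G.girth - 1) (by omega)
    rwa [show G.girth - 1 + 1 = w.length by omega, w.getVert_length] at this

end SimpleGraph

section

variable {V : Type*} {G : SimpleGraph V}

/-- The condition on a pair `x, y` in the definition of `IsRVDColoring`. -/
def HasRainbowCut (G : SimpleGraph V) (c : V → ℕ) (x y : V) : Prop :=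
  ∃ S : Set V, x ∉ S ∧ y ∉ S ∧
    (∀ p : (G.deleteEdges {s(x, y)}).Walk x y, ∃ v ∈ p.support, v ∈ S) ∧
    (¬ G.Adj x y → RainbowSet c S) ∧
    (G.Adj x y → (RainbowSet c (insert x S) ∨ RainbowSet c (insert y S)))

lemma HasRainbowCut.symm {c : V → ℕ} {x y : V} (h : HasRainbowCut G c x y) :
    HasRainbowCut G c y x := by
  obtain ⟨S, hx, hy, hw, hn, ha⟩ := h
  refine ⟨S, hy, hx, ?_, fun h => hn fun h' => h h'.symm, fun h => (ha h.symm).symm⟩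
  rw [Sym2.eq_swap]
  intro p
  simpa using hw p.reverse

/-- The neighbourhood of `x` yields a rainbow cut if it is rainbow and `x` has a private color. -/
lemma hasRainbowCut_of_neighborSet {c : V → ℕ} {x y : V} (hxy : x ≠ y)
    (hN : RainbowSet c (G.neighborSet x)) (hx : ∀ w, c w = c x → w = x) :
    HasRainbowCut G c x y := by
  have hS : RainbowSet c (G.neighborSet x \ {y}) := hN.mono Set.sdiff_subset
  refine ⟨G.neighborSet x \ {y}, by simp, by simp, fun p => ?_, fun _ => hS, fun _ => Or.inl ?_⟩
  · refine p.exists_mem_support_of_boundary (T := {x}) rfl (by simpa using hxy.symm) ?_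
    rintro a rfl b hb hab
    rw [deleteEdges_adj] at hab
    refine Or.inr ⟨hab.1, ?_⟩
    rintro rfl
    exact hab.2 rfl
  · rw [RainbowSet, Set.injOn_insert (by simp)]
    refine ⟨hS, ?_⟩
    rintro ⟨w, hw, he⟩
    obtain rfl := hx w he
    exact G.loopless.irrefl _ hw.1

/-- The coloring of an enumerated cycle used below: color `0` on the first two vertices, color `1`
on the others, and private colors off the cycle. -/
structure IsCycleColoring (g : ℕ) (v : ℕ → V) (c : V → ℕ) : Prop where
  zero : ∀ i < g, i < 2 → c (v i) = 0
  one : ∀ i < g, 2 ≤ i → c (v i) = 1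
  eq_of_eq : ∀ w, (∀ k < g, w ≠ v k) → ∀ u, c u = c w → u = w

namespace IsCycleColoring

variable {g : ℕ} {v : ℕ → V} {c : V → ℕ}

lemma rainbowSet (hc : IsCycleColoring g v c) {a b : ℕ} (hab : c (v a) ≠ c (v b)) :
    RainbowSet c {w | (∀ k < g, w ≠ v k) ∨ w = v a ∨ w = v b} := by
  rintro x (hx | rfl | rfl) y (hy | rfl | rfl) he
  all_goals first
    | rfl
    | exact absurd he hab
    | exact absurd he.symm hab
    | exact hc.eq_of_eq _ hy _ he
    | exact (hc.eq_of_eq _ hx _ he.symm).symm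

/-- Transfers a cut between two cycle vertices from indices to vertices. -/
lemma exists_mem_support (hv : G.IsCycleEnum g v) (hg : G.girth = g) {i j a b : ℕ} (hi : i < g)
    (hj : j < g) (K : ℕ → Prop) (hKi : K i) (hKj : ¬ K j)
    (hK : ∀ k l, k < l → l < g → (l = k + 1 ∨ (k = 0 ∧ l = g - 1)) → ¬ (K k ↔ K l) →
      (k = a ∨ k = b ∨ l = a ∨ l = b) ∨ (k = i ∧ l = j) ∨ (k = j ∧ l = i))
    (p : (G.deleteEdges {s(v i, v j)}).Walk (v i) (v j)) :
    ∃ w ∈ p.support, w ∈ {w | (∀ k < g, w ≠ v k) ∨ w = v a ∨ w = v b} := by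
  refine p.exists_mem_support_of_boundary (T := {w | ∃ k < g, w = v k ∧ K k})
    ⟨i, hi, rfl, hKi⟩ ?_ ?_
  · rintro ⟨k, hk, he, hKk⟩
    exact hKj (hv.injOn _ hj _ hk he ▸ hKk)
  · rintro _ ⟨k, hk, rfl, hKk⟩ w hw hadj
    rw [deleteEdges_adj] at hadj
    obtain ⟨hadj, hne⟩ := hadj
    by_cases hwC : ∀ l < g, w ≠ v l
    · exact Or.inr (Or.inl hwC)
    push Not at hwC
    obtain ⟨l, hl, rfl⟩ := hwC
    have hKl : ¬ K l := fun h => hw ⟨l, hl, rfl, h⟩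
    have hfin : (k = a ∨ k = b ∨ l = a ∨ l = b) ∨ (k = i ∧ l = j) ∨ (k = j ∧ l = i) := by
      rcases lt_trichotomy k l with h | h | h
      · exact hK k l h hl (hv.eq_succ_or_of_adj hg h hl hadj) (by tauto)
      · exact absurd (h ▸ hKk) hKl
      · have := hK l k h hk (hv.eq_succ_or_of_adj hg h hk hadj.symm) (by tauto)
        tauto
    rcases hfin with (rfl | rfl | rfl | rfl) | ⟨rfl, rfl⟩ | ⟨rfl, rfl⟩
    · exact Or.inl (Or.inr (Or.inl rfl))
    · exact Or.inl (Or.inr (Or.inr rfl))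
    · exact Or.inr (Or.inr (Or.inl rfl))
    · exact Or.inr (Or.inr (Or.inr rfl))
    · exact absurd rfl hne
    · exact absurd Sym2.eq_swap hne

/-- Cutting two nonadjacent cycle vertices at the two cycle vertices `v a` and `v b`. -/
lemma hasRainbowCut_of_not_adj (hc : IsCycleColoring g v c) (hv : G.IsCycleEnum g v)
    (hg : G.girth = g) {i j a b : ℕ} (hi : i < g) (hj : j < g) (ha : a < g) (hb : b < g)
    (hadj : ¬ G.Adj (v i) (v j)) (hne : i ≠ a ∧ i ≠ b ∧ j ≠ a ∧ j ≠ b)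
    (hab : c (v a) ≠ c (v b)) (K : ℕ → Prop) (hKi : K i) (hKj : ¬ K j)
    (hK : ∀ k l, k < l → l < g → (l = k + 1 ∨ (k = 0 ∧ l = g - 1)) → ¬ (K k ↔ K l) →
      (k = a ∨ k = b ∨ l = a ∨ l = b) ∨ (k = i ∧ l = j) ∨ (k = j ∧ l = i)) :
    HasRainbowCut G c (v i) (v j) := by
  have hmem : ∀ k < g, k ≠ a → k ≠ b →
      v k ∉ {w | (∀ k < g, w ≠ v k) ∨ w = v a ∨ w = v b} := by
    rintro k hk hka hkb (h | h | h)
    · exact h k hk rfl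
    · exact hka (hv.injOn _ hk _ ha h)
    · exact hkb (hv.injOn _ hk _ hb h)
  exact ⟨_, hmem i hi hne.1 hne.2.1, hmem j hj hne.2.2.1 hne.2.2.2,
    exists_mem_support hv hg hi hj K hKi hKj hK, fun _ => hc.rainbowSet hab,
    fun h => absurd h hadj⟩

/-- Cutting two adjacent cycle vertices at the cycle vertex `v a`. -/
lemma hasRainbowCut_of_adj (hc : IsCycleColoring g v c) (hv : G.IsCycleEnum g v)
    (hg : G.girth = g) {i j a : ℕ} (hi : i < g) (hj : j < g) (ha : a < g)
    (hadj : G.Adj (v i) (v j)) (hne : i ≠ a ∧ j ≠ a)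
    (haj : c (v a) ≠ c (v j)) (K : ℕ → Prop) (hKi : K i) (hKj : ¬ K j)
    (hK : ∀ k l, k < l → l < g → (l = k + 1 ∨ (k = 0 ∧ l = g - 1)) → ¬ (K k ↔ K l) →
      (k = a ∨ k = a ∨ l = a ∨ l = a) ∨ (k = i ∧ l = j) ∨ (k = j ∧ l = i)) :
    HasRainbowCut G c (v i) (v j) := by
  have hmem : ∀ k < g, k ≠ a → v k ∉ {w | (∀ k < g, w ≠ v k) ∨ w = v a ∨ w = v a} := by
    rintro k hk hka (h | h | h)
    · exact h k hk rfl
    all_goals exact hka (hv.injOn _ hk _ ha h)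
  refine ⟨_, hmem i hi hne.1, hmem j hj hne.2,
    exists_mem_support hv hg hi hj K hKi hKj hK, fun h => absurd hadj h,
    fun _ => Or.inr ((hc.rainbowSet haj).mono ?_)⟩
  rintro w (rfl | h | h | h)
  · exact Or.inr (Or.inr rfl)
  · exact Or.inl h
  all_goals exact Or.inr (Or.inl h)

lemma hasRainbowCut_of_lt (hc : IsCycleColoring g v c) (hv : G.IsCycleEnum g v)
    (hg : G.girth = g) (hg4 : 4 ≤ g) {i j : ℕ} (hij : i < j) (hj : j < g) :
    HasRainbowCut G c (v i) (v j) := by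
  have h01 : ∀ k l, k < g → l < g → k < 2 → 2 ≤ l → c (v k) ≠ c (v l) := by
    intro k l hk hl hk2 hl2
    rw [hc.zero k hk hk2, hc.one l hl hl2]
    exact zero_ne_one
  by_cases hadj : G.Adj (v i) (v j)
  · rcases hv.eq_succ_or_of_adj hg hij hj hadj with rfl | ⟨rfl, rfl⟩
    · rcases Nat.eq_zero_or_pos i with rfl | hi
      · exact hc.hasRainbowCut_of_adj hv hg (a := 2) (by omega) hj (by omega) hadj (by omega)
          (h01 1 2 (by omega) (by omega) (by omega) le_rfl).symm (fun k => k ≠ 1) (by omega)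
          (by omega) (by intros; omega)
      · exact hc.hasRainbowCut_of_adj hv hg (a := 0) (by omega) hj (by omega) hadj (by omega)
          (h01 0 (i + 1) (by omega) hj (by omega) (by omega)) (fun k => 1 ≤ k ∧ k ≤ i) (by omega)
          (by omega) (by intros; omega)
    · exact hc.hasRainbowCut_of_adj hv hg (a := 1) (by omega) hj (by omega) hadj (by omega)
        (h01 1 (g - 1) (by omega) hj (by omega) (by omega)) (fun k => k = 0) rfl
        (by omega) (by intros; omega)
  · have hj1 : j ≠ i + 1 := by
      rintro rfl
      exact hadj (hv.adj i hj)
    rcases Nat.eq_zero_or_pos i with rfl | hi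
    · have hjl : j ≠ g - 1 := by
        rintro rfl
        exact hadj hv.adj_last.symm
      exact hc.hasRainbowCut_of_not_adj hv hg (a := 1) (b := g - 1) (by omega) hj (by omega)
        (by omega) hadj (by omega) (h01 1 (g - 1) (by omega) (by omega) (by omega) (by omega))
        (fun k => k = 0) rfl (by omega) (by intros; omega)
    · exact hc.hasRainbowCut_of_not_adj hv hg (a := i + 1) (b := 0) (by omega) hj (by omega)
        (by omega) hadj (by omega) (h01 0 (i + 1) (by omega) (by omega) (by omega)
        (by omega)).symm (fun k => 1 ≤ k ∧ k ≤ i) (by omega) (by omega) (by intros; omega)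

lemma rainbowSet_neighborSet (hc : IsCycleColoring g v c) (hv : G.IsCycleEnum g v)
    (hg : G.girth = g) (hg4 : 4 ≤ g) {x : V} (hx : ∀ k < g, x ≠ v k) :
    RainbowSet c (G.neighborSet x) := by
  have key : ∀ i j, i < j → j < g → G.Adj x (v i) → G.Adj x (v j) → c (v i) ≠ c (v j) := by
    intro i j hij hj hi' hj'
    have := hv.le_of_adj_of_adj hg hx hij hj hi' hj'
    rw [hc.zero i (by omega) (by omega), hc.one j hj (by omega)]
    exact zero_ne_one
  intro u hu w hw he
  by_cases hwC : ∀ k < g, w ≠ v k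
  · exact hc.eq_of_eq w hwC u he
  by_cases huC : ∀ k < g, u ≠ v k
  · exact (hc.eq_of_eq u huC w he.symm).symm
  push Not at hwC huC
  obtain ⟨i, hi, rfl⟩ := huC
  obtain ⟨j, hj, rfl⟩ := hwC
  rcases lt_trichotomy i j with h | h | h
  · exact absurd he (key i j h hj hu hw)
  · rw [h]
  · exact absurd he.symm (key j i h hi hw hu)

lemma isRVDColoring (hc : IsCycleColoring g v c) (hv : G.IsCycleEnum g v)
    (hg : G.girth = g) (hg4 : 4 ≤ g) : IsRVDColoring G c := by
  have hoff : ∀ x y, x ≠ y → (∀ k < g, x ≠ v k) → HasRainbowCut G c x y := fun x y hxy hx =>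
    hasRainbowCut_of_neighborSet hxy (hc.rainbowSet_neighborSet hv hg hg4 hx) (hc.eq_of_eq x hx)
  intro x y hxy
  change HasRainbowCut G c x y
  by_cases hx : ∀ k < g, x ≠ v k
  · exact hoff x y hxy hx
  by_cases hy : ∀ k < g, y ≠ v k
  · exact (hoff y x hxy.symm hy).symm
  push Not at hx hy
  obtain ⟨i, hi, rfl⟩ := hx
  obtain ⟨j, hj, rfl⟩ := hy
  rcases lt_trichotomy i j with h | h | h
  · exact hc.hasRainbowCut_of_lt hv hg hg4 h hj
  · exact absurd (h ▸ rfl) hxy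
  · exact (hc.hasRainbowCut_of_lt hv hg hg4 h hi).symm

end IsCycleColoring

lemma exists_isCycleColoring [Fintype V] {g : ℕ} {v : ℕ → V} (hv : G.IsCycleEnum g v)
    (hg2 : 2 ≤ g) :
    ∃ c, IsCycleColoring g v c ∧ (Set.range c).ncard ≤ Fintype.card V - g + 2 := by
  classical
  let e := Fintype.equivFin V
  let C : Finset V := (Finset.range g).image v
  have hC : C.card = g := by
    rw [Finset.card_image_of_injOn, Finset.card_range]
    intro i hi j hj h
    exact hv.injOn i (by simpa using hi) j (by simpa using hj) h
  have hmem : ∀ w, w ∈ C ↔ ∃ k < g, v k = w := by simp [C]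
  refine ⟨fun w => if w = v 0 ∨ w = v 1 then 0 else if w ∈ C then 1 else 2 + e w,
    ⟨fun i _ hi2 => ?_, fun i hi hi2 => ?_, fun w hw u he => ?_⟩, ?_⟩
  · have : i = 0 ∨ i = 1 := by omega
    rcases this with rfl | rfl <;> simp
  · have h0 : v i ≠ v 0 := fun h => by
      have := hv.injOn _ hi _ (by omega) h
      omega
    have h1 : v i ≠ v 1 := fun h => by
      have := hv.injOn _ hi _ (by omega) h
      omega
    have hi' : v i ∈ C := (hmem _).mpr ⟨i, hi, rfl⟩
    simp [h0, h1, hi']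
  · have hwC : w ∉ C := by
      rw [hmem]
      rintro ⟨k, hk, h⟩
      exact hw k hk h.symm
    have h0 := hw 0 (by omega)
    have h1 := hw 1 (by omega)
    simp only [h0, h1, hwC, or_self, if_false] at he
    split_ifs at he
    · omega
    · omega
    · exact e.injective (Fin.ext (by omega))
  · have hsub : Set.range (fun w => if w = v 0 ∨ w = v 1 then 0 else if w ∈ C then 1
        else 2 + (e w : ℕ)) ⊆ ((Cᶜ.image fun w => 2 + (e w : ℕ)) ∪ {0, 1} : Finset ℕ) := by
      rintro _ ⟨w, rfl⟩
      by_cases hw : w ∈ C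
      · by_cases h : w = v 0 ∨ w = v 1 <;> simp [h, hw]
      · by_cases h : w = v 0 ∨ w = v 1
        · simp [h]
        · simp only [h, hw, if_false]
          exact Finset.mem_coe.mpr (Finset.mem_union_left _
            (Finset.mem_image_of_mem (fun w => 2 + (e w : ℕ)) (Finset.mem_compl.mpr hw)))
    refine (Set.ncard_le_ncard hsub (Finset.finite_toSet _)).trans ?_
    rw [Set.ncard_coe_finset]
    refine (Finset.card_union_le _ _).trans (Nat.add_le_add ?_ Finset.card_le_two)
    refine Finset.card_image_le.trans ?_
    rw [Finset.card_compl, hC]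

end

/-- For a nontrivial connected graph `G` of order `n` and girth `g ≥ 4`,
`rvd G ≤ n - g + 2`. -/
theorem stmt10 {V : Type*} [Fintype V] (G : SimpleGraph V) (hG : G.Connected)
    (hn : 2 ≤ Fintype.card V) (g : ℕ) (hg : G.girth = g) (hg4 : 4 ≤ g) :
    rvd G ≤ Fintype.card V - g + 2 := by
  subst hg
  obtain ⟨v, hv⟩ := exists_isCycleEnum_girth (G := G) (by omega)
  obtain ⟨c, hc, hcard⟩ := exists_isCycleColoring hv (by omega)
  refine le_trans (Nat.sInf_le ?_) hcard
  exact ⟨c, hc.isRVDColoring hv rfl hg4, rfl⟩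
end

section
/- Let G be a nontrivial connected triangle-free graph of order n ≥ 3. Then rvd(G) ≤ n − 2. -/
open SimpleGraph

/-- A walk from `x` to `y` avoiding the edge `xy` passes through a neighbor of `x` other than
`y`. -/
theorem exists_mem_support_neighborSet_diff {V : Type*} {G : SimpleGraph V} {x y : V}
    (hxy : x ≠ y) (p : (G.deleteEdges {s(x, y)}).Walk x y) :
    ∃ v ∈ p.support, v ∈ G.neighborSet x \ {y} := by
  cases p with
  | nil => exact absurd rfl hxy
  | @cons _ w _ h q =>
    rw [deleteEdges_adj] at h
    refine ⟨w, by simp, h.1, ?_⟩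
    rintro rfl
    exact h.2 rfl

/-- A coloring is a rainbow vertex-disconnection coloring as soon as all neighborhoods but at
most one are rainbow. -/
theorem isRVDColoring_of_rainbowSet_neighborSet {V : Type*} {G : SimpleGraph V} {c : V → ℕ}
    (z : V) (h : ∀ x, x ≠ z → RainbowSet c (G.neighborSet x)) : IsRVDColoring G c := by
  intro x y hxy
  by_cases hx : x = z
  · have hy := h y (hx ▸ hxy.symm)
    refine ⟨G.neighborSet y \ {x}, by simp, by simp, fun p => ?_,
      fun _ => hy.mono Set.sdiff_subset, fun hadj => Or.inl (hy.mono ?_)⟩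
    · obtain ⟨v, hv, hvS⟩ := exists_mem_support_neighborSet_diff hxy.symm
        (p.reverse.mapLe (by rw [Sym2.eq_swap]))
      exact ⟨v, by simpa using hv, hvS⟩
    · exact Set.insert_subset hadj.symm Set.sdiff_subset
  · have hx := h x hx
    exact ⟨G.neighborSet x \ {y}, by simp, by simp, exists_mem_support_neighborSet_diff hxy,
      fun _ => hx.mono Set.sdiff_subset,
      fun hadj => Or.inr (hx.mono (Set.insert_subset hadj Set.sdiff_subset))⟩

/-- If a map `f` misses two vertices and is injective on all neighborhoods but at most one, then
`rvd G` is at most the order of `G` minus two. -/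
theorem rvd_le_card_sub_two_of_injOn {V : Type*} [Fintype V] {G : SimpleGraph V} (f : V → V)
    {a b : V} (hab : a ≠ b) (ha : ∀ v, f v ≠ a) (hb : ∀ v, f v ≠ b) (z : V)
    (h : ∀ x, x ≠ z → Set.InjOn f (G.neighborSet x)) : rvd G ≤ Fintype.card V - 2 := by
  have he : Function.Injective fun v : V => (Fintype.equivFin V v : ℕ) :=
    Fin.val_injective.comp (Fintype.equivFin V).injective
  have hc : IsRVDColoring G ((fun v => (Fintype.equivFin V v : ℕ)) ∘ f) :=
    isRVDColoring_of_rainbowSet_neighborSet z fun x hx => he.comp_injOn (h x hx)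
  have hle : rvd G ≤ (Set.range ((fun v => (Fintype.equivFin V v : ℕ)) ∘ f)).ncard :=
    Nat.sInf_le ⟨_, hc, rfl⟩
  refine hle.trans ?_
  rw [Set.range_comp, Set.ncard_image_of_injective _ he]
  have hsub : Set.range f ⊆ ({a, b} : Set V)ᶜ := by
    rintro _ ⟨v, rfl⟩
    simp [ha v, hb v]
  calc (Set.range f).ncard ≤ ({a, b} : Set V)ᶜ.ncard := Set.ncard_le_ncard hsub
    _ = Fintype.card V - 2 := by
      rw [Set.ncard_compl, Set.ncard_pair hab, Nat.card_eq_fintype_card]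

theorem not_adj_of_cliqueFree_three {V : Type*} {G : SimpleGraph V} (htf : G.CliqueFree 3)
    {x a b : V} (hab : G.Adj a b) (ha : G.Adj x a) : ¬ G.Adj x b := by
  classical
  exact fun hb => htf {x, a, b} (is3Clique_triple_iff.2 ⟨ha, hb, hab⟩)

/-- Coloring each of two disjoint edges with a single color. -/
theorem rvd_le_card_sub_two_of_disjoint_edges {V : Type*} [Fintype V] {G : SimpleGraph V}
    (htf : G.CliqueFree 3) {a b c d : V} (hab : G.Adj a b) (hcd : G.Adj c d)
    (hac : a ≠ c) (had : a ≠ d) (hbc : b ≠ c) (hbd : b ≠ d) :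
    rvd G ≤ Fintype.card V - 2 := by
  classical
  refine rvd_le_card_sub_two_of_injOn (fun v => if v = b then a else if v = d then c else v)
    hbd ?_ ?_ a ?_
  · intro v
    have := hab.ne
    grind
  · intro v
    have := hcd.ne
    grind
  · intro x _ u hu v hv huv
    have h1 := @not_adj_of_cliqueFree_three _ _ htf x _ _ hab
    have h2 := @not_adj_of_cliqueFree_three _ _ htf x _ _ hcd
    simp only [mem_neighborSet] at hu hv
    grind

/-- Either a path on three vertices can be colored with a single color, or there are two disjoint
edges. -/
theorem rvd_le_card_sub_two_of_path {V : Type*} [Fintype V] {G : SimpleGraph V}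
    (htf : G.CliqueFree 3) {u v w : V} (huv : G.Adj u v) (hvw : G.Adj v w) (huw : u ≠ w) :
    rvd G ≤ Fintype.card V - 2 := by
  classical
  by_cases hz : ∃ z, z ≠ v ∧ G.Adj z u ∧ G.Adj z w
  · obtain ⟨z, hzv, hzu, hzw⟩ := hz
    exact rvd_le_card_sub_two_of_disjoint_edges htf hzu hvw hzv hzw.ne huv.ne huw
  · refine rvd_le_card_sub_two_of_injOn (fun x => if x = u ∨ x = w then v else x) huw ?_ ?_ v ?_
    · intro x
      have := huv.ne
      grind
    · intro x
      have := hvw.ne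
      grind
    · intro x hx s hs t ht hst
      have h1 := @not_adj_of_cliqueFree_three _ _ htf x _ _ huv
      have h2 := @not_adj_of_cliqueFree_three _ _ htf x _ _ hvw
      simp only [mem_neighborSet] at hs ht
      grind

/-- For a nontrivial connected triangle-free graph `G` of order `n ≥ 3`,
`rvd G ≤ n - 2`. -/
theorem stmt11 {V : Type*} [Fintype V] (G : SimpleGraph V) (hG : G.Connected)
    (hn : 3 ≤ Fintype.card V) (htf : G.CliqueFree 3) :
    rvd G ≤ Fintype.card V - 2 := by
  have : Nontrivial V := Fintype.one_lt_card_iff_nontrivial.1 (by omega)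
  have hadj := hG.preconnected.exists_adj_of_nontrivial
  obtain ⟨a⟩ := hG.nonempty
  obtain ⟨b, hab⟩ := hadj a
  obtain ⟨c, hca, hcb⟩ : ∃ c, c ≠ a ∧ c ≠ b := by
    classical
    obtain ⟨c, hc⟩ := Finset.exists_mem_notMem_of_card_lt_card
      (s := {a, b}) (t := Finset.univ) (by rw [Finset.card_pair hab.ne, Finset.card_univ]; omega)
    exact ⟨c, by simpa using hc⟩
  obtain ⟨d, hcd⟩ := hadj c
  by_cases hda : d = a
  · subst hda
    exact rvd_le_card_sub_two_of_path htf hcd hab hcb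
  by_cases hdb : d = b
  · subst hdb
    exact rvd_le_card_sub_two_of_path htf hcd hab.symm hca
  exact rvd_le_card_sub_two_of_disjoint_edges htf hab hcd hca.symm (Ne.symm hda) hcb.symm
    (Ne.symm hdb)
end
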